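/- For all integers r ≥ 2 and n ≥ 2r, (0.513)^{r−2}·n ≤ NGΠ↓ⁿ_η(r;n) ≤ 2^{r−1}(n − 2r + 2). -/

import Mathlib

open scoped Classical

namespace NG

/-- The set of earlier neighbors (back-neighborhood) of vertex `j` in `H`,
with respect to the natural order on `Fin N`. -/
noncomputable def backNbhd {N : ℕ} (H : SimpleGraph (Fin N)) (j : Fin N) :
    Finset (Fin N) :=
  Finset.univ.filter (fun i => (i : ℕ) < (j : ℕ) ∧ H.Adj i j)

/-- The degree of `u` in the subgraph of `H` induced on the first `j` vertices
(the "stage `j`" graph of the construction). -/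
noncomputable def stageDeg {N : ℕ} (H : SimpleGraph (Fin N)) (j : ℕ) (u : Fin N) : ℕ :=
  (Finset.univ.filter (fun w : Fin N => (w : ℕ) < j ∧ (u : ℕ) < j ∧ H.Adj u w)).card

/-- `H` on `Fin N` is a `k`-tree, built in the natural vertex order: the first
`k+1` vertices form a clique, and every later vertex is joined exactly to the
vertices of an existing `k`-clique. -/
def IsKTreeOrd (k : ℕ) (N : ℕ) (H : SimpleGraph (Fin N)) : Prop :=
  1 ≤ k ∧ k + 1 ≤ N ∧
  (∀ i j : Fin N, (i : ℕ) < (j : ℕ) → (j : ℕ) ≤ k → H.Adj i j) ∧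
  (∀ j : Fin N, k < (j : ℕ) →
    (backNbhd H j).card = k ∧ H.IsClique (backNbhd H j : Set (Fin N)))

/-- A linear `k`-tree: a `k`-tree in which each new vertex (after the first added
one) is joined to a `k`-clique containing the vertex added at the previous step. -/
def IsLinearKTreeOrd (k : ℕ) (N : ℕ) (H : SimpleGraph (Fin N)) : Prop :=
  IsKTreeOrd k N H ∧
  ∀ i j : Fin N, (i : ℕ) + 1 = (j : ℕ) → k + 1 < (j : ℕ) → i ∈ backNbhd H j

/-- A `k`-caterpillar: a `k`-tree in which each new vertex (after the first added
one) is joined to a `k`-clique contained in the maximal `(k+1)`-clique created at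
the previous stage. -/
def IsCaterpillarOrd (k : ℕ) (N : ℕ) (H : SimpleGraph (Fin N)) : Prop :=
  IsKTreeOrd k N H ∧
  ∀ i j : Fin N, (i : ℕ) + 1 = (j : ℕ) → k + 1 < (j : ℕ) →
    backNbhd H j ⊆ insert i (backNbhd H i)

/-- A two-sided `k`-tree: a `k`-tree in which each new vertex is joined to a
`k`-clique that either contains a vertex of degree `k` (at that stage) or equals
the `k`-clique to which some previously added vertex was joined. -/
def IsTwoSidedKTreeOrd (k : ℕ) (N : ℕ) (H : SimpleGraph (Fin N)) : Prop :=
  IsKTreeOrd k N H ∧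
  ∀ j : Fin N, k < (j : ℕ) →
    ((∃ u ∈ backNbhd H j, stageDeg H (j : ℕ) u = k) ∨
     (∃ i : Fin N, k < (i : ℕ) ∧ (i : ℕ) < (j : ℕ) ∧ backNbhd H i = backNbhd H j))

/-- The least `k` such that `G` embeds as a subgraph into some graph in the
class `P k`; an edgeless graph gets the value `0`. -/
noncomputable def widthParam (P : ℕ → (N : ℕ) → SimpleGraph (Fin N) → Prop)
    (n : ℕ) (G : SimpleGraph (Fin n)) : ℕ :=
  if G = ⊥ then 0
  else sInf {k | ∃ (N : ℕ) (H : SimpleGraph (Fin N)) (f : Fin n ↪ Fin N),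
    P k N H ∧ ∀ u v : Fin n, G.Adj u v → H.Adj (f u) (f v)}

/-- Tree-width: the least `k` such that `G` is a subgraph of a `k`-tree. -/
noncomputable def treewidth (n : ℕ) (G : SimpleGraph (Fin n)) : ℕ :=
  widthParam IsKTreeOrd n G

/-- Largeur d'arborescence: the least `k` such that `G` is a subgraph of a
two-sided `k`-tree. -/
noncomputable def la (n : ℕ) (G : SimpleGraph (Fin n)) : ℕ :=
  widthParam IsTwoSidedKTreeOrd n G

/-- Path-width: the least `k` such that `G` is a subgraph of a `k`-caterpillar. -/
noncomputable def pw (n : ℕ) (G : SimpleGraph (Fin n)) : ℕ :=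
  widthParam IsCaterpillarOrd n G

/-- Proper path-width: the least `k` such that `G` is a subgraph of a linear
`k`-tree. -/
noncomputable def ppw (n : ℕ) (G : SimpleGraph (Fin n)) : ℕ :=
  widthParam IsLinearKTreeOrd n G

/-- `G` has a complete-graph minor on `m` branch sets: there are `m` pairwise
disjoint nonempty connected vertex sets with an edge between every two of them. -/
def HasCliqueMinor {n : ℕ} (G : SimpleGraph (Fin n)) (m : ℕ) : Prop :=
  ∃ B : Fin m → Finset (Fin n),
    (∀ p, (B p).Nonempty) ∧
    (∀ p, (G.induce ((B p : Finset (Fin n)) : Set (Fin n))).Connected) ∧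
    (∀ p q, p ≠ q → Disjoint (B p) (B q)) ∧
    (∀ p q, p ≠ q → ∃ u ∈ B p, ∃ v ∈ B q, G.Adj u v)

/-- The Hadwiger number: the largest `m` such that `K_m` is a minor of `G`. -/
noncomputable def hadwiger (n : ℕ) (G : SimpleGraph (Fin n)) : ℕ :=
  sSup {m | HasCliqueMinor G m}

/-- `A` is a symmetric matrix whose off-diagonal nonzero pattern is the
adjacency of `G`. -/
def DescribesGraph {n : ℕ} (A : Matrix (Fin n) (Fin n) ℝ)
    (G : SimpleGraph (Fin n)) : Prop :=
  A.IsSymm ∧ ∀ i j : Fin n, i ≠ j → (A i j ≠ 0 ↔ G.Adj i j)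

/-- The Strong Arnold Property: the only symmetric `X` with `AX = O`,
`A∘X = O` and `I∘X = O` is `X = O`. -/
def StrongArnold {n : ℕ} (A : Matrix (Fin n) (Fin n) ℝ) : Prop :=
  ∀ X : Matrix (Fin n) (Fin n) ℝ, X.IsSymm → A * X = 0 →
    (∀ i j, A i j * X i j = 0) → (∀ i, X i i = 0) → X = 0

/-- The nullity of a square real matrix. -/
noncomputable def nullity {n : ℕ} (A : Matrix (Fin n) (Fin n) ℝ) : ℕ :=
  Module.finrank ℝ (LinearMap.ker (Matrix.toLin' A))

/-- The Colin de Verdière type parameter `ξ`: maximum nullity of a matrix in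
`S(G)` with the Strong Arnold Property. -/
noncomputable def xiParam (n : ℕ) (G : SimpleGraph (Fin n)) : ℕ :=
  sSup {m | ∃ A : Matrix (Fin n) (Fin n) ℝ,
    DescribesGraph A G ∧ StrongArnold A ∧ nullity A = m}

/-- The Colin de Verdière type parameter `ν`: maximum nullity of a positive
semidefinite matrix in `S(G)` with the Strong Arnold Property. -/
noncomputable def nuParam (n : ℕ) (G : SimpleGraph (Fin n)) : ℕ :=
  sSup {m | ∃ A : Matrix (Fin n) (Fin n) ℝ,
    DescribesGraph A G ∧ A.PosSemidef ∧ StrongArnold A ∧ nullity A = m}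

/-- The Colin de Verdière number `μ`: maximum nullity of a generalized
Laplacian in `S(G)` with exactly one negative eigenvalue and the Strong Arnold
Property. -/
noncomputable def muParam (n : ℕ) (G : SimpleGraph (Fin n)) : ℕ :=
  sSup {m | ∃ (A : Matrix (Fin n) (Fin n) ℝ) (hA : A.IsHermitian),
    DescribesGraph A G ∧ StrongArnold A ∧
    (Finset.univ.filter (fun i => hA.eigenvalues i < 0)).card = 1 ∧
    (∀ i j : Fin n, i ≠ j → A i j ≤ 0) ∧ nullity A = m}

/-- An `r`-decomposition of `K_n`: spanning subgraphs with pairwise disjoint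
edge sets whose union is all of `K_n`. -/
def IsDecomp {n r : ℕ} (G : Fin r → SimpleGraph (Fin n)) : Prop :=
  (∀ i j : Fin r, i ≠ j → Disjoint (G i) (G j)) ∧ (⨆ i, G i) = ⊤

/-- A non-degenerate `r`-decomposition: every part has at least one edge. -/
def IsNDDecomp {n r : ℕ} (G : Fin r → SimpleGraph (Fin n)) : Prop :=
  IsDecomp G ∧ ∀ i, G i ≠ ⊥

/-- Nordhaus–Gaddum sum upper bound `NGΣ↑_β(r;n)`. -/
noncomputable def NGsumUp {n : ℕ} (β : SimpleGraph (Fin n) → ℕ) (r : ℕ) : ℕ :=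
  sSup {s | ∃ G : Fin r → SimpleGraph (Fin n), IsDecomp G ∧ ∑ i, β (G i) = s}

/-- Nordhaus–Gaddum sum lower bound `NGΣ↓_β(r;n)`. -/
noncomputable def NGsumLow {n : ℕ} (β : SimpleGraph (Fin n) → ℕ) (r : ℕ) : ℕ :=
  sInf {s | ∃ G : Fin r → SimpleGraph (Fin n), IsDecomp G ∧ ∑ i, β (G i) = s}

/-- Non-degenerate Nordhaus–Gaddum sum lower bound `NGΣ↓ⁿ_β(r;n)`. -/
noncomputable def NGsumLowND {n : ℕ} (β : SimpleGraph (Fin n) → ℕ) (r : ℕ) : ℕ :=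
  sInf {s | ∃ G : Fin r → SimpleGraph (Fin n), IsNDDecomp G ∧ ∑ i, β (G i) = s}

/-- Nordhaus–Gaddum product upper bound `NGΠ↑_β(r;n)`. -/
noncomputable def NGprodUp {n : ℕ} (β : SimpleGraph (Fin n) → ℕ) (r : ℕ) : ℕ :=
  sSup {s | ∃ G : Fin r → SimpleGraph (Fin n), IsDecomp G ∧ ∏ i, β (G i) = s}

/-- Non-degenerate Nordhaus–Gaddum product upper bound `NGΠ↑ⁿ_β(r;n)`. -/
noncomputable def NGprodUpND {n : ℕ} (β : SimpleGraph (Fin n) → ℕ) (r : ℕ) : ℕ :=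
  sSup {s | ∃ G : Fin r → SimpleGraph (Fin n), IsNDDecomp G ∧ ∏ i, β (G i) = s}

/-- Nordhaus–Gaddum product lower bound `NGΠ↓_β(r;n)`. -/
noncomputable def NGprodLow {n : ℕ} (β : SimpleGraph (Fin n) → ℕ) (r : ℕ) : ℕ :=
  sInf {s | ∃ G : Fin r → SimpleGraph (Fin n), IsDecomp G ∧ ∏ i, β (G i) = s}

/-- Non-degenerate Nordhaus–Gaddum product lower bound `NGΠ↓ⁿ_β(r;n)`. -/
noncomputable def NGprodLowND {n : ℕ} (β : SimpleGraph (Fin n) → ℕ) (r : ℕ) : ℕ :=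
  sInf {s | ∃ G : Fin r → SimpleGraph (Fin n), IsNDDecomp G ∧ ∏ i, β (G i) = s}

/-- The triangular root `t(r) = ⌈√(2r + 1/4) − 1/2⌉`. -/
noncomputable def trt (r : ℕ) : ℕ := ⌈Real.sqrt (2 * (r : ℝ) + 1 / 4) - 1 / 2⌉₊

/-- `H` is a path together with isolated vertices: its edges are exactly those
of a path through some list of distinct vertices. -/
def IsPathGraph {n : ℕ} (H : SimpleGraph (Fin n)) : Prop :=
  ∃ (m : ℕ) (f : Fin (m + 1) ↪ Fin n), ∀ u v : Fin n,
    H.Adj u v ↔ ∃ a b : Fin (m + 1), (a : ℕ) + 1 = (b : ℕ) ∧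
      ((u = f a ∧ v = f b) ∨ (u = f b ∧ v = f a))

end NG

set_option linter.unusedSectionVars false

namespace NGP

variable {V : Type*} [DecidableEq V]

def Conn (G : SimpleGraph V) (T : Finset V) : Prop := (G.induce (T : Set V)).Connected

def MAdj (G : SimpleGraph V) (X Y : Finset V) : Prop := ∃ u ∈ X, ∃ v ∈ Y, G.Adj u v

/-- A clique minor of order `m` inside the vertex set `S`. -/
def Mnr (G : SimpleGraph V) (S : Finset V) (m : ℕ) : Prop :=
  ∃ F : Finset (Finset V), F.card = m ∧ (∀ T ∈ F, T ⊆ S ∧ Conn G T) ∧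
    ∀ T ∈ F, ∀ T' ∈ F, T ≠ T' → Disjoint T T' ∧ MAdj G T T'

/-- Every clique minor of `G` inside `S` has order at most `k`. -/
def Bd (G : SimpleGraph V) (S : Finset V) (k : ℕ) : Prop := ∀ m, Mnr G S m → m ≤ k

def Dom (G : SimpleGraph V) (S D : Finset V) : Prop :=
  ∀ v ∈ S, v ∉ D → ∃ d ∈ D, G.Adj d v

def Ind (G : SimpleGraph V) (I : Finset V) : Prop :=
  ∀ u ∈ I, ∀ v ∈ I, ¬ G.Adj u v

/-- Connected inside each component. -/
def CC (G : SimpleGraph V) (S D : Finset V) : Prop :=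
  ∀ u ∈ D, ∀ v ∈ D, ∀ T ⊆ S, u ∈ T → v ∈ T → Conn G T →
    ∃ T' ⊆ D, u ∈ T' ∧ v ∈ T' ∧ Conn G T'

lemma Conn.nonempty {G : SimpleGraph V} {T : Finset V} (h : Conn G T) : T.Nonempty := by
  obtain ⟨x⟩ := SimpleGraph.Connected.nonempty h
  exact ⟨x.1, x.2⟩

lemma MAdj.symm {G : SimpleGraph V} {X Y : Finset V} (h : MAdj G X Y) : MAdj G Y X := by
  obtain ⟨u, hu, v, hv, a⟩ := h
  exact ⟨v, hv, u, hu, a.symm⟩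

lemma conn_singleton (G : SimpleGraph V) (x : V) : Conn G {x} := by
  unfold Conn
  apply SimpleGraph.induce_connected_of_patches x (by simp)
  intro v hv
  simp at hv
  subst hv
  exact ⟨{v}, by simp, rfl, rfl, SimpleGraph.Reachable.refl _⟩

lemma Conn.union {G : SimpleGraph V} {X Y : Finset V} (hX : Conn G X) (hY : Conn G Y)
    {z : V} (h1 : z ∈ X) (h2 : z ∈ Y) : Conn G (X ∪ Y) := by
  unfold Conn
  rw [Finset.coe_union]
  exact SimpleGraph.induce_union_connected hX.preconnected hY.preconnected ⟨z, h1, h2⟩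

lemma conn_pair {G : SimpleGraph V} {u v : V} (h : G.Adj u v) : Conn G {u, v} := by
  unfold Conn
  have := SimpleGraph.induce_pair_connected_of_adj h
  rwa [Finset.coe_pair]

lemma Conn.union_adj {G : SimpleGraph V} {X Y : Finset V} (hX : Conn G X) (hY : Conn G Y)
    (h : MAdj G X Y) : Conn G (X ∪ Y) := by
  obtain ⟨u, hu, v, hv, a⟩ := h
  have h1 := hX.union (conn_pair a) hu (by simp)
  have h2 := h1.union hY (z := v) (by simp) hv
  convert h2 using 1
  ext w
  simp only [Finset.mem_union, Finset.mem_insert, Finset.mem_singleton]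
  constructor
  · tauto
  · rintro ((h | h | h) | h)
    · tauto
    · subst h; tauto
    · subst h; tauto
    · tauto

lemma Conn.insert_adj {G : SimpleGraph V} {X : Finset V} (hX : Conn G X) {x y : V}
    (hx : x ∈ X) (h : G.Adj x y) : Conn G (insert y X) := by
  have := (conn_singleton G y).union_adj hX ⟨y, by simp, x, hx, h.symm⟩
  rwa [Finset.insert_eq]

lemma conn_of_patches {G : SimpleGraph V} {X : Finset V} (u : V) (hu : u ∈ X)
    (h : ∀ v ∈ X, ∃ T ⊆ X, u ∈ T ∧ v ∈ T ∧ Conn G T) : Conn G X := by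
  apply SimpleGraph.induce_connected_of_patches u hu
  intro v hv
  obtain ⟨T, hT, h1, h2, h3⟩ := h v hv
  exact ⟨T, by exact_mod_cast hT, h1, h2, h3.preconnected _ _⟩

lemma conn_star {G : SimpleGraph V} {X : Finset V} (x : V) (h : ∀ v ∈ X, G.Adj x v) :
    Conn G (insert x X) := by
  apply conn_of_patches x (by simp)
  intro v hv
  rcases Finset.mem_insert.1 hv with rfl | hv
  · exact ⟨{v}, by simp, by simp, by simp, conn_singleton G v⟩
  · refine ⟨{x, v}, ?_, by simp, by simp, conn_pair (h v hv)⟩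
    intro w hw
    simp at hw
    rcases hw with rfl | rfl
    · simp
    · simp [hv]

lemma conn_clique {G : SimpleGraph V} {X : Finset V} (hX : X.Nonempty)
    (h : ∀ u ∈ X, ∀ v ∈ X, u ≠ v → G.Adj u v) : Conn G X := by
  obtain ⟨x, hx⟩ := hX
  have := conn_star (G := G) (X := X.erase x) x (fun v hv => by
    simp at hv
    exact h x hx v hv.2 (Ne.symm hv.1))
  rwa [Finset.insert_erase hx] at this

lemma Conn.cross {G : SimpleGraph V} {T : Finset V} (hT : Conn G T) (p : V → Prop) {u v : V}
    (hu : u ∈ T) (hv : v ∈ T) (pu : p u) (pv : ¬ p v) :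
    ∃ x ∈ T, ∃ y ∈ T, p x ∧ ¬ p y ∧ G.Adj x y := by
  obtain ⟨w⟩ := hT.preconnected ⟨u, hu⟩ ⟨v, hv⟩
  obtain ⟨d, _, h1, h2⟩ := w.exists_boundary_dart {z | p z.1} pu pv
  exact ⟨d.fst.1, d.fst.2, d.snd.1, d.snd.2, h1, h2, d.adj⟩

lemma Mnr.mono {G : SimpleGraph V} {S S' : Finset V} (h : S ⊆ S') {m : ℕ} (hm : Mnr G S m) :
    Mnr G S' m := by
  obtain ⟨F, h1, h2, h3⟩ := hm
  exact ⟨F, h1, fun T hT => ⟨(h2 T hT).1.trans h, (h2 T hT).2⟩, h3⟩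

lemma Bd.mono {G : SimpleGraph V} {S S' : Finset V} (h : S ⊆ S') {k : ℕ} (hm : Bd G S' k) :
    Bd G S k := fun m hm' => hm m (hm'.mono h)

lemma mnr_one {G : SimpleGraph V} {S : Finset V} (h : S.Nonempty) : Mnr G S 1 := by
  obtain ⟨x, hx⟩ := h
  refine ⟨{{x}}, by simp, ?_, ?_⟩
  · intro T hT
    simp at hT
    subst hT
    exact ⟨by simpa using hx, conn_singleton G x⟩
  · intro T hT T' hT' hne
    simp at hT hT'
    exact absurd (hT.trans hT'.symm) hne

lemma mnr_clique {G : SimpleGraph V} {S K : Finset V} (hK : K ⊆ S)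
    (h : ∀ u ∈ K, ∀ v ∈ K, u ≠ v → G.Adj u v) : Mnr G S K.card := by
  refine ⟨K.image (fun x => {x}), ?_, ?_, ?_⟩
  · exact Finset.card_image_of_injective _ Finset.singleton_injective
  · intro T hT
    simp at hT
    obtain ⟨x, hx, rfl⟩ := hT
    exact ⟨by simpa using hK hx, conn_singleton G x⟩
  · intro T hT T' hT' hne
    simp at hT hT'
    obtain ⟨x, hx, rfl⟩ := hT
    obtain ⟨y, hy, rfl⟩ := hT'
    have : x ≠ y := fun e => hne (by rw [e])
    exact ⟨by simpa using this, x, by simp, y, by simp, h x hx y hy this⟩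

/-- add one branch set to a minor -/
lemma mnr_insert {G : SimpleGraph V} {S S' X : Finset V} (hS : S' ⊆ S) (hX : X ⊆ S)
    (hc : Conn G X) {F : Finset (Finset V)}
    (h2 : ∀ T ∈ F, T ⊆ S' ∧ Conn G T)
    (h3 : ∀ T ∈ F, ∀ T' ∈ F, T ≠ T' → Disjoint T T' ∧ MAdj G T T')
    (h4 : ∀ T ∈ F, Disjoint X T ∧ MAdj G X T) : Mnr G S (F.card + 1) := by
  have hn : X ∉ F := by
    intro h
    have := (h4 X h).1
    obtain ⟨x, hx⟩ := hc.nonempty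
    exact Finset.disjoint_left.1 this hx hx
  refine ⟨insert X F, Finset.card_insert_of_notMem hn, ?_, ?_⟩
  · intro T hT
    rcases Finset.mem_insert.1 hT with rfl | hT
    · exact ⟨hX, hc⟩
    · exact ⟨(h2 T hT).1.trans hS, (h2 T hT).2⟩
  · intro T hT T' hT' hne
    rcases Finset.mem_insert.1 hT with e1 | h1 <;> rcases Finset.mem_insert.1 hT' with e2 | h5
    · exact absurd (e1.trans e2.symm) hne
    · rw [e1]; exact h4 _ h5
    · rw [e2]; exact ⟨(h4 _ h1).1.symm, (h4 _ h1).2.symm⟩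
    · exact h3 _ h1 _ h5 hne

lemma mnr_drop {G : SimpleGraph V} {S D : Finset V} (hS : S.Nonempty) (hD : D ⊆ S)
    (hdom : Dom G S D) (hcc : CC G S D) {m : ℕ} (hm : Mnr G (S \ D) m) : Mnr G S (m + 1) := by
  obtain ⟨F, h1, h2, h3⟩ := hm
  rcases F.eq_empty_or_nonempty with rfl | ⟨T0, hT0⟩
  · simp at h1
    subst h1
    exact mnr_one hS
  have key : ∀ T ∈ F, ∃ d ∈ D, ∃ b ∈ T, G.Adj d b := by
    intro T hT
    obtain ⟨b, hb⟩ := (h2 T hT).2.nonempty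
    have hb' := (h2 T hT).1 hb
    simp at hb'
    obtain ⟨d, hd, ha⟩ := hdom b hb'.1 hb'.2
    exact ⟨d, hd, b, hb, ha⟩
  obtain ⟨d0, hd0, b0, hb0, ha0⟩ := key T0 hT0
  set X := D.filter (fun d => ∃ T' ⊆ D, d0 ∈ T' ∧ d ∈ T' ∧ Conn G T') with hX
  have hsd : S \ D ⊆ S := Finset.sdiff_subset
  subst h1
  apply mnr_insert (X := X) hsd ((Finset.filter_subset _ _).trans hD) _ h2 h3
  · intro T hT
    constructor
    · rw [Finset.disjoint_left]
      intro x hx hx'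
      have := (h2 T hT).1 hx'
      simp [hX] at hx this
      exact this.2 hx.1
    · obtain ⟨d, hd, b, hb, ha⟩ := key T hT
      refine ⟨d, ?_, b, hb, ha⟩
      rw [hX, Finset.mem_filter]
      refine ⟨hd, ?_⟩
      have c1 : Conn G (T0 ∪ T) := by
        by_cases e : T0 = T
        · subst e
          simpa using (h2 T0 hT0).2
        · exact (h2 T0 hT0).2.union_adj (h2 T hT).2 (h3 _ hT0 _ hT e).2
      have c2 : Conn G (insert d (insert d0 (T0 ∪ T))) :=
        (c1.insert_adj (x := b0) (y := d0) (by simp [hb0]) ha0.symm).insert_adj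
          (x := b) (by simp [hb]) ha.symm
      refine hcc d0 hd0 d hd _ ?_ (by simp) (by simp) c2
      intro w hw
      simp only [Finset.mem_insert, Finset.mem_union] at hw
      rcases hw with rfl | rfl | hw | hw
      · exact hD hd
      · exact hD hd0
      · exact hsd ((h2 _ hT0).1 hw)
      · exact hsd ((h2 _ hT).1 hw)
  · have hd0' : d0 ∈ X := by
      rw [hX, Finset.mem_filter]
      exact ⟨hd0, {d0}, by simpa using hd0, by simp, by simp, conn_singleton _ _⟩
    apply conn_of_patches d0 hd0'
    intro v hv
    rw [hX, Finset.mem_filter] at hv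
    obtain ⟨hv, T', hT', h5, h6, h7⟩ := hv
    refine ⟨T', ?_, h5, h6, h7⟩
    intro w hw
    rw [hX, Finset.mem_filter]
    exact ⟨hT' hw, T', hT', h5, hw, h7⟩

lemma Bd.drop {G : SimpleGraph V} {S D : Finset V} (hS : S.Nonempty) (hD : D ⊆ S)
    (hdom : Dom G S D) (hcc : CC G S D) {k : ℕ} (hk : Bd G S k) : Bd G (S \ D) (k - 1) := by
  intro m hm
  have := hk _ (mnr_drop hS hD hdom hcc hm)
  omega

lemma Bd.pos {G : SimpleGraph V} {S : Finset V} (hS : S.Nonempty) {k : ℕ} (hk : Bd G S k) :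
    1 ≤ k := hk _ (mnr_one hS)

lemma cc_of_conn {G : SimpleGraph V} {S D : Finset V} (h : Conn G D) : CC G S D :=
  fun u hu v hv _ _ _ _ _ => ⟨D, le_rfl, hu, hv, h⟩

lemma cc_extend {G : SimpleGraph V} {S D D' : Finset V} (h : CC G S D) (hDD : D ⊆ D')
    (hD' : D' ⊆ S)
    (hp : ∀ u ∈ D', ∃ u0 ∈ D, ∃ P ⊆ D', u ∈ P ∧ u0 ∈ P ∧ Conn G P) : CC G S D' := by
  intro u hu v hv T hT huT hvT hc
  obtain ⟨u0, hu0, P, hP, p1, p2, p3⟩ := hp u hu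
  obtain ⟨v0, hv0, Q, hQ, q1, q2, q3⟩ := hp v hv
  have c1 : Conn G ((T ∪ P) ∪ Q) := (hc.union p3 huT p1).union q3 (z := v) (by simp [hvT]) q1
  obtain ⟨T', t1, t2, t3, t4⟩ := h u0 hu0 v0 hv0 ((T ∪ P) ∪ Q)
    (Finset.union_subset (Finset.union_subset hT (hP.trans hD')) (hQ.trans hD'))
    (by simp [p2]) (by simp [q2]) c1
  refine ⟨(T' ∪ P) ∪ Q, Finset.union_subset (Finset.union_subset (t1.trans hDD) hP) hQ,
    by simp [p1], by simp [q1], ?_⟩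
  exact (t4.union p3 t2 p2).union q3 (z := v0) (by simp [t3]) q2

lemma ind_insert {G : SimpleGraph V} {I : Finset V} {x : V} (hI : Ind G I)
    (hx : ∀ d ∈ I, ¬ G.Adj d x) : Ind G (insert x I) := by
  intro u hu v hv
  rcases Finset.mem_insert.1 hu with e1 | h1 <;> rcases Finset.mem_insert.1 hv with e2 | h2
  · rw [e1, e2]; exact G.loopless.irrefl _
  · rw [e1]; exact fun a => hx v h2 a.symm
  · rw [e2]; exact hx u h1
  · exact hI u h1 v h2

lemma dm_ext (G : SimpleGraph V) (S : Finset V) (c : ℕ) : ∀ (N : ℕ) (D I : Finset V),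
    S.card - D.card ≤ N → D ⊆ S → I ⊆ D → Ind G I → D.card + c ≤ 2 * I.card → CC G S D →
    ∃ D' I', D' ⊆ S ∧ I' ⊆ D' ∧ Ind G I' ∧ D'.card + c ≤ 2 * I'.card ∧ CC G S D' ∧
      Dom G S D' := by
  intro N
  induction N with
  | zero =>
    intro D I h0 h1 h2 h3 h4 h5
    have : D = S := Finset.eq_of_subset_of_card_le h1 (by omega)
    subst this
    exact ⟨D, I, h1, h2, h3, h4, h5, fun v hv hn => absurd hv hn⟩
  | succ N ih =>
    intro D I h0 h1 h2 h3 h4 h5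
    by_cases hdom : Dom G S D
    · exact ⟨D, I, h1, h2, h3, h4, h5, hdom⟩
    by_cases hx : ∃ x ∈ S, x ∉ D ∧ (∀ d ∈ D, ¬ G.Adj d x) ∧
        ∃ y ∈ S, G.Adj y x ∧ ∃ d ∈ D, G.Adj d y
    · obtain ⟨x, xS, xD, hxd, y, yS, hyx, d, hd, hdy⟩ := hx
      have yD : y ∉ D := fun h => hxd y h hyx
      have hyx' : y ≠ x := hyx.ne
      have hyI : y ∉ insert x D := by simp [hyx', yD]
      have hc : (insert y (insert x D)).card = D.card + 2 := by
        rw [Finset.card_insert_of_notMem hyI, Finset.card_insert_of_notMem xD]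
      have hcI : (insert x I).card = I.card + 1 :=
        Finset.card_insert_of_notMem (fun h => xD (h2 h))
      have hsub : insert y (insert x D) ⊆ S := by
        intro w hw
        simp only [Finset.mem_insert] at hw
        rcases hw with rfl | rfl | hw
        · exact yS
        · exact xS
        · exact h1 hw
      have hDs : D ⊆ insert y (insert x D) := fun w hw => by simp [hw]
      refine ih (insert y (insert x D)) (insert x I) (by omega) hsub ?_
        (ind_insert h3 (fun d hd => hxd d (h2 hd))) (by omega) ?_
      · intro w hw
        rcases Finset.mem_insert.1 hw with rfl | hw
        · simp
        · simp [h2 hw]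
      · apply cc_extend h5 hDs hsub
        have hpath : Conn G (insert x (insert y {d})) :=
          ((conn_singleton G d).insert_adj (by simp) hdy).insert_adj (x := y) (by simp) hyx
        have hps : insert x (insert y {d}) ⊆ insert y (insert x D) := by
          intro w hw
          simp only [Finset.mem_insert, Finset.mem_singleton] at hw ⊢
          rcases hw with rfl | rfl | rfl
          · tauto
          · tauto
          · tauto
        intro u hu
        simp only [Finset.mem_insert] at hu
        rcases hu with rfl | rfl | hu
        · exact ⟨d, hd, _, hps, by simp, by simp, hpath⟩
        · exact ⟨d, hd, _, hps, by simp, by simp, hpath⟩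
        · exact ⟨u, hu, {u}, by simpa using hDs hu, by simp, by simp, conn_singleton _ _⟩
    · have : ∃ x ∈ S, x ∉ D ∧ ∀ d ∈ D, ¬ G.Adj d x := by
        unfold Dom at hdom
        push Not at hdom
        exact hdom
      obtain ⟨x, xS, xD, hxd⟩ := this
      have hc : (insert x D).card = D.card + 1 := Finset.card_insert_of_notMem xD
      have hcI : (insert x I).card = I.card + 1 :=
        Finset.card_insert_of_notMem (fun h => xD (h2 h))
      have hno : ∀ v ∈ D, ∀ T ⊆ S, x ∈ T → v ∈ T → ¬ Conn G T := by
        intro v hv T hT hxT hvT hconn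
        obtain ⟨a, ha, b, hb, pa, pb, hab⟩ := hconn.cross
          (fun z => z ∉ D ∧ ∀ d ∈ D, ¬ G.Adj d z) hxT hvT ⟨xD, hxd⟩ (fun h => h.1 hv)
        have hbD : b ∉ D := fun h => pa.2 b h hab.symm
        have : ∃ d ∈ D, G.Adj d b := by
          by_contra hcon
          push Not at hcon
          exact pb ⟨hbD, hcon⟩
        exact hx ⟨a, hT ha, pa.1, pa.2, b, hT hb, hab.symm, this⟩
      refine ih (insert x D) (insert x I) (by omega) ?_ ?_
        (ind_insert h3 (fun d hd => hxd d (h2 hd))) (by omega) ?_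
      · exact Finset.insert_subset xS h1
      · exact Finset.insert_subset_insert x h2
      · intro u hu v hv T hT huT hvT hconn
        rcases Finset.mem_insert.1 hu with e1 | hu1 <;> rcases Finset.mem_insert.1 hv with e2 | hv1
        · exact ⟨{x}, by simp, by simp [e1], by simp [e2], conn_singleton _ _⟩
        · exact absurd hconn (hno v hv1 T hT (e1 ▸ huT) hvT)
        · exact absurd hconn (hno u hu1 T hT (e2 ▸ hvT) huT)
        · obtain ⟨T', t1, t2⟩ := h5 u hu1 v hv1 T hT huT hvT hconn
          exact ⟨T', t1.trans (Finset.subset_insert _ _), t2⟩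

/-- Duchet--Meyniel. -/
lemma duchet_meyniel (G : SimpleGraph V) (a : ℕ) : ∀ (k : ℕ) (S : Finset V), Bd G S k →
    (∀ I ⊆ S, Ind G I → I.card ≤ a) → S.card ≤ k * (2 * a - 1) := by
  intro k
  induction k with
  | zero =>
    intro S hb _
    rcases S.eq_empty_or_nonempty with rfl | hS
    · simp
    · have := hb.pos hS
      omega
  | succ k ih =>
    intro S hb ha
    rcases S.eq_empty_or_nonempty with rfl | hS
    · simp
    obtain ⟨x, hx⟩ := id hS
    obtain ⟨D, I, d1, d2, d3, d4, d5, d6⟩ := dm_ext G S 1 _ {x} {x} le_rfl (by simpa using hx)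
      le_rfl (by intro u hu v hv; simp at hu hv; subst hu; subst hv; exact G.loopless.irrefl _)
      (by simp) (cc_of_conn (conn_singleton G x))
    have h1 := ih (S \ D) (by simpa using hb.drop hS d1 d6 d5)
      (fun I hI => ha I (hI.trans Finset.sdiff_subset))
    have h2 := ha I (d2.trans d1) d3
    have h3 := Finset.card_sdiff_add_card_eq_card d1
    have : D.card ≤ 2 * a - 1 := by omega
    calc S.card = (S \ D).card + D.card := h3.symm
      _ ≤ k * (2 * a - 1) + (2 * a - 1) := by omega
      _ = (k + 1) * (2 * a - 1) := by ring


lemma no_adj_of_bd_one {G : SimpleGraph V} {S : Finset V} (h : Bd G S 1) :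
    ∀ u ∈ S, ∀ v ∈ S, ¬ G.Adj u v := by
  intro u hu v hv a
  have hne := a.ne
  have := h _ (mnr_clique (G := G) (S := S) (K := {u, v}) (by
    intro w hw
    simp at hw
    rcases hw with rfl | rfl
    · exact hu
    · exact hv) (by
    intro x hx y hy hxy
    simp at hx hy
    rcases hx with e1 | e1 <;> rcases hy with e2 | e2
    · exact absurd (e1.trans e2.symm) hxy
    · rw [e1, e2]; exact a
    · rw [e1, e2]; exact a.symm
    · exact absurd (e1.trans e2.symm) hxy))
  rw [Finset.card_pair hne] at this
  omega

lemma two_step {G H : SimpleGraph V} {S : Finset V} {k k' : ℕ} (hkk : k ≤ k') (hS : S.Nonempty)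
    (hG : Bd G S k) (hH : Bd H S k')
    (hc : ∀ u ∈ S, ∀ v ∈ S, u ≠ v → G.Adj u v ∨ H.Adj u v) :
    (∃ D ⊆ S, D.Nonempty ∧ D.card ≤ k' ∧ Conn G D ∧ Dom G S D) ∨
    (∃ D ⊆ S, D.Nonempty ∧ D.card ≤ k ∧ Conn H D ∧ Dom H S D) ∨ S.card ≤ k * k' := by
  by_contra hcon
  push Not at hcon
  obtain ⟨n1, n2, n3⟩ := hcon
  have hk1 := hG.pos hS
  have nG : ∀ D ⊆ S, D.card ≤ k' → Conn G D → ∃ w ∈ S, w ∉ D ∧ (∀ d ∈ D, ¬ G.Adj d w) ∧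
      ∀ d ∈ D, H.Adj d w := by
    intro D hD hcard hconn
    have := n1 D hD hconn.nonempty hcard hconn
    unfold Dom at this
    push Not at this
    obtain ⟨w, hw, hwD, hn⟩ := this
    refine ⟨w, hw, hwD, hn, fun d hd => ?_⟩
    rcases hc d (hD hd) w hw (fun e => hwD (e ▸ hd)) with h | h
    · exact absurd h (hn d hd)
    · exact h
  have nH : ∀ D ⊆ S, D.card ≤ k → Conn H D → ∃ w ∈ S, w ∉ D ∧ ∀ d ∈ D, G.Adj d w := by
    intro D hD hcard hconn
    have := n2 D hD hconn.nonempty hcard hconn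
    unfold Dom at this
    push Not at this
    obtain ⟨w, hw, hwD, hn⟩ := this
    refine ⟨w, hw, hwD, fun d hd => ?_⟩
    rcases hc d (hD hd) w hw (fun e => hwD (e ▸ hd)) with h | h
    · exact h
    · exact absurd h (hn d hd)
  by_cases hk : k = 1
  · subst hk
    have h1 := no_adj_of_bd_one hG
    have := hH _ (mnr_clique (G := H) (K := S) le_rfl (fun u hu v hv hne => by
      rcases hc u hu v hv hne with h | h
      · exact absurd h (h1 u hu v hv)
      · exact h))
    omega
  have hcl : ∀ t, 1 ≤ t → t ≤ k → ∃ K ⊆ S, K.card = t ∧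
      ∀ u ∈ K, ∀ v ∈ K, u ≠ v → G.Adj u v := by
    intro t
    induction t with
    | zero => intro h; omega
    | succ t ih =>
      intro _ htk
      rcases Nat.eq_zero_or_pos t with rfl | ht
      · obtain ⟨x, hx⟩ := hS
        refine ⟨{x}, by simpa using hx, by simp, ?_⟩
        intro u hu v hv hne
        simp at hu hv
        exact absurd (hu.trans hv.symm) hne
      obtain ⟨K, hK, hKc, hKcl⟩ := ih ht (by omega)
      have hKne : K.Nonempty := Finset.card_pos.1 (by omega)
      obtain ⟨w, hw, hwK, _, hwH⟩ := nG K hK (by omega) (conn_clique hKne hKcl)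
      obtain ⟨x, hx, hxn, hxG⟩ := nH (insert w K) (Finset.insert_subset hw hK)
        (by rw [Finset.card_insert_of_notMem hwK]; omega)
        (conn_star w (fun v hv => (hwH v hv).symm))
      have hxK : x ∉ K := fun h => hxn (by simp [h])
      refine ⟨insert x K, Finset.insert_subset hx hK, by
        rw [Finset.card_insert_of_notMem hxK]; omega, ?_⟩
      intro u hu v hv hne
      rcases Finset.mem_insert.1 hu with e1 | h1 <;> rcases Finset.mem_insert.1 hv with e2 | h2
      · exact absurd (e1.trans e2.symm) hne
      · rw [e1]; exact (hxG v (by simp [h2])).symm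
      · rw [e2]; exact hxG u (by simp [h1])
      · exact hKcl u h1 v h2 hne
  obtain ⟨K, hK, hKc, hKcl⟩ := hcl k hk1 le_rfl
  have hKne : K.Nonempty := Finset.card_pos.1 (by omega)
  obtain ⟨v, hv, hvK, hvG, hvH⟩ := nG K hK (by omega) (conn_clique hKne hKcl)
  have hu : ∀ a, ∃ u, a ∈ K → u ∈ S ∧ G.Adj v u ∧ ∀ b ∈ K, b ≠ a → G.Adj b u := by
    intro a
    by_cases ha : a ∈ K
    · obtain ⟨u, hu1, hu2, hu3⟩ := nH (insert v (K.erase a))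
        (Finset.insert_subset hv ((Finset.erase_subset _ _).trans hK))
        (by rw [Finset.card_insert_of_notMem (by simp [hvK]), Finset.card_erase_of_mem ha]; omega)
        (conn_star v (fun b hb => (hvH b (Finset.mem_of_mem_erase hb)).symm))
      exact ⟨u, fun _ => ⟨hu1, hu3 v (by simp), fun b hb hba => hu3 b (by simp [hb, hba])⟩⟩
    · exact ⟨a, fun h => absurd h ha⟩
  choose u hu using hu
  have huK : ∀ a ∈ K, u a ∉ K := fun a ha h => hvG _ h (hu a ha).2.1.symm
  have hXc : Conn G (insert v (K.image u)) := conn_star v (by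
    intro w hw
    simp at hw
    obtain ⟨a, ha, rfl⟩ := hw
    exact (hu a ha).2.1)
  have hm : Mnr G S ((K.image (fun x => ({x} : Finset V))).card + 1) := by
    apply mnr_insert (X := insert v (K.image u)) (S' := K) hK _ hXc
    · intro T hT
      simp at hT
      obtain ⟨x, hx, rfl⟩ := hT
      exact ⟨by simpa using hx, conn_singleton G x⟩
    · intro T hT T' hT' hne
      simp at hT hT'
      obtain ⟨x, hx, rfl⟩ := hT
      obtain ⟨y, hy, rfl⟩ := hT'
      have : x ≠ y := fun e => hne (by rw [e])
      exact ⟨by simpa using this, x, by simp, y, by simp, hKcl x hx y hy this⟩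
    · intro T hT
      simp at hT
      obtain ⟨x, hx, rfl⟩ := hT
      constructor
      · rw [Finset.disjoint_singleton_right]
        intro h
        simp at h
        rcases h with h | ⟨a, ha, h⟩
        · exact hvK (h ▸ hx)
        · exact huK a ha (h ▸ hx)
      · obtain ⟨a, ha, hax⟩ := Finset.exists_mem_ne (s := K) (by omega) x
        refine ⟨u a, ?_, x, by simp, ((hu a ha).2.2 x hx hax.symm).symm⟩
        simp only [Finset.mem_insert, Finset.mem_image]
        exact Or.inr ⟨a, ha, rfl⟩
    · apply Finset.insert_subset hv
      intro w hw
      simp at hw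
      obtain ⟨a, ha, rfl⟩ := hw
      exact (hu a ha).1
  rw [Finset.card_image_of_injective _ Finset.singleton_injective] at hm
  have := hG _ hm
  omega

lemma two_color : ∀ (N : ℕ) (G H : SimpleGraph V) (S : Finset V) (k k' : ℕ), S.card ≤ N →
    Bd G S k → Bd H S k' → (∀ u ∈ S, ∀ v ∈ S, u ≠ v → G.Adj u v ∨ H.Adj u v) →
    S.card ≤ k * k' := by
  intro N
  induction N with
  | zero => intro G H S k k' h; omega
  | succ N ih =>
    intro G H S k k' hN hG hH hc
    rcases S.eq_empty_or_nonempty with rfl | hS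
    · simp
    have sub : ∀ (D : Finset V), D ⊆ S → D.Nonempty → (S \ D).card + D.card = S.card ∧
        (S \ D).card ≤ N := by
      intro D hD hDn
      have h1 := Finset.card_sdiff_add_card_eq_card hD
      have h2 := hDn.card_pos
      exact ⟨h1, by omega⟩
    have hc' : ∀ D : Finset V, ∀ u ∈ S \ D, ∀ v ∈ S \ D, u ≠ v → G.Adj u v ∨ H.Adj u v :=
      fun D u hu v hv => hc u (Finset.mem_sdiff.1 hu).1 v (Finset.mem_sdiff.1 hv).1
    have k1 := hG.pos hS
    have k2 := hH.pos hS
    have useG : ∀ D ⊆ S, D.Nonempty → D.card ≤ k' → Conn G D → Dom G S D → S.card ≤ k * k' := by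
      intro D hD hDn hDc hconn hdom
      have h1 := ih G H (S \ D) (k - 1) k' (sub D hD hDn).2
        (hG.drop hS hD hdom (cc_of_conn hconn)) (hH.mono Finset.sdiff_subset) (hc' D)
      have h2 := (sub D hD hDn).1
      obtain ⟨l, rfl⟩ : ∃ l, k = l + 1 := ⟨k - 1, by omega⟩
      simp at h1
      rw [add_mul]
      omega
    have useH : ∀ D ⊆ S, D.Nonempty → D.card ≤ k → Conn H D → Dom H S D → S.card ≤ k * k' := by
      intro D hD hDn hDc hconn hdom
      have h1 := ih G H (S \ D) k (k' - 1) (sub D hD hDn).2 (hG.mono Finset.sdiff_subset)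
        (hH.drop hS hD hdom (cc_of_conn hconn)) (hc' D)
      have h2 := (sub D hD hDn).1
      obtain ⟨l, rfl⟩ : ∃ l, k' = l + 1 := ⟨k' - 1, by omega⟩
      simp at h1
      rw [mul_add]
      omega
    rcases le_total k k' with hkk | hkk
    · rcases two_step hkk hS hG hH hc with ⟨D, d1, d2, d3, d4, d5⟩ | ⟨D, d1, d2, d3, d4, d5⟩ | h
      · exact useG D d1 d2 d3 d4 d5
      · exact useH D d1 d2 d3 d4 d5
      · exact h
    · rcases two_step hkk hS hH hG (fun u hu v hv hne => (hc u hu v hv hne).symm) with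
        ⟨D, d1, d2, d3, d4, d5⟩ | ⟨D, d1, d2, d3, d4, d5⟩ | h
      · exact useH D d1 d2 d3 d4 d5
      · exact useG D d1 d2 d3 d4 d5
      · rwa [mul_comm]

lemma turan_arith {u t a X : ℕ} (h : u ^ 2 ≤ a * X) : (u + t) ^ 2 ≤ (a + 1) * (X + t ^ 2) := by
  have h2 : 2 * u * t ≤ X + a * t ^ 2 := by
    have : (2 * u * t) ^ 2 ≤ (X + a * t ^ 2) ^ 2 := by
      zify at h ⊢
      have h3 : (u : ℤ) ^ 2 * t ^ 2 ≤ a * X * t ^ 2 :=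
        mul_le_mul_of_nonneg_right h (by positivity)
      nlinarith [sq_nonneg ((X : ℤ) - a * t ^ 2)]
    exact (Nat.pow_le_pow_iff_left (by norm_num)).1 this
  nlinarith

lemma turan (R : V → V → Prop) (hR : ∀ u v, R u v → R v u) (hi : ∀ u, ¬ R u u) :
    ∀ (N : ℕ) (U : Finset V), U.card ≤ N → ∃ I ⊆ U, (∀ u ∈ I, ∀ v ∈ I, ¬ R u v) ∧
      U.card ^ 2 ≤ I.card * ∑ x ∈ U, ((U.filter (R x)).card + 1) := by
  intro N
  induction N with
  | zero =>
    intro U hU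
    have : U = ∅ := Finset.card_eq_zero.1 (by omega)
    subst this
    exact ⟨∅, by simp, by simp, by simp⟩
  | succ N ih =>
    intro U hU
    rcases U.eq_empty_or_nonempty with rfl | hUn
    · exact ⟨∅, by simp, by simp, by simp⟩
    obtain ⟨x, hx, hmin⟩ := Finset.exists_min_image U (fun x => (U.filter (R x)).card) hUn
    set M := insert x (U.filter (R x)) with hM
    have hMU : M ⊆ U := Finset.insert_subset hx (Finset.filter_subset _ _)
    have hMc : M.card = (U.filter (R x)).card + 1 :=
      Finset.card_insert_of_notMem (by simp [hi])
    have hcard := Finset.card_sdiff_add_card_eq_card hMU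
    obtain ⟨I, hI1, hI2, hI3⟩ := ih (U \ M) (by omega)
    have hxI : x ∉ I := fun h => by
      have := hI1 h
      simp [hM] at this
    have hIR : ∀ v ∈ I, ¬ R x v := fun v hv hr => by
      have := hI1 hv
      simp [hM] at this
      exact this.2.2 this.1 hr
    refine ⟨insert x I, Finset.insert_subset hx (hI1.trans Finset.sdiff_subset), ?_, ?_⟩
    · intro u hu v hv
      rcases Finset.mem_insert.1 hu with e1 | h1 <;> rcases Finset.mem_insert.1 hv with e2 | h2
      · rw [e1, e2]; exact hi x
      · rw [e1]; exact hIR v h2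
      · rw [e2]; exact fun h => hIR u h1 (hR _ _ h)
      · exact hI2 u h1 v h2
    · have hsum : (∑ y ∈ U \ M, (((U \ M).filter (R y)).card + 1)) + M.card ^ 2 ≤
          ∑ y ∈ U, ((U.filter (R y)).card + 1) := by
        rw [← Finset.sum_sdiff hMU]
        apply add_le_add
        · apply Finset.sum_le_sum
          intro y _
          have := Finset.card_le_card
            (Finset.filter_subset_filter (R y) (Finset.sdiff_subset (s := U) (t := M)))
          omega
        · rw [sq, ← smul_eq_mul]
          apply Finset.card_nsmul_le_sum
          intro y hy
          have := hmin y (hMU hy)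
          omega
      rw [Finset.card_insert_of_notMem hxI, ← hcard]
      exact (turan_arith hI3).trans (Nat.mul_le_mul_left _ hsum)

lemma drc1 (G : SimpleGraph V) (S : Finset V) (r s : ℕ) (hs : 1 ≤ s)
    (hE : S.card ^ 2 ≤ 2 * r * ∑ x ∈ S, (S.filter (G.Adj x)).card)
    (hn : 12 * r ^ 2 * s ^ 3 < S.card) :
    ∃ I ⊆ S, s ≤ I.card ∧ ∀ y ∈ I, ∀ z ∈ I, y ≠ z →
      s ^ 2 + s ≤ (S.filter (fun x => G.Adj x y ∧ G.Adj x z)).card := by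
  by_contra hcon
  push Not at hcon
  set b := s ^ 2 + s with hb
  obtain ⟨R, hRd⟩ : ∃ R : V → V → Prop, ∀ y z, R y z ↔ (y ≠ z ∧
    (S.filter (fun x => G.Adj x y ∧ G.Adj x z)).card < b) := ⟨_, fun _ _ => Iff.rfl⟩
  have hsym : ∀ u v, R u v → R v u := by
    intro u v huv
    obtain ⟨h1, h2⟩ := (hRd u v).1 huv
    rw [hRd]
    refine ⟨h1.symm, ?_⟩
    simpa only [and_comm] using h2
  have key : ∀ x ∈ S, (S.filter (G.Adj x)).card ^ 2 ≤
      s * ∑ y ∈ S.filter (G.Adj x), (((S.filter (G.Adj x)).filter (R y)).card + 1) := by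
    intro x hx
    obtain ⟨I, h1, h2, h3⟩ := turan R hsym (fun u h => ((hRd u u).1 h).1 rfl) _ (S.filter (G.Adj x)) le_rfl
    refine h3.trans (Nat.mul_le_mul_right _ ?_)
    by_contra hlt
    push Not at hlt
    obtain ⟨y, hy, z, hz, hyz, hlt'⟩ := hcon I (h1.trans (Finset.filter_subset _ _)) hlt.le
    exact h2 y hy z hz ((hRd y z).2 ⟨hyz, hlt'⟩)
  set E := ∑ x ∈ S, (S.filter (G.Adj x)).card with hEdef
  have hB : ∑ x ∈ S, ∑ y ∈ S.filter (G.Adj x), ((S.filter (G.Adj x)).filter (R y)).card ≤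
      S.card * (S.card * b) := by
    have e1 : ∀ x, ∑ y ∈ S.filter (G.Adj x), ((S.filter (G.Adj x)).filter (R y)).card =
        ∑ y ∈ S, ∑ z ∈ S, if (G.Adj x y ∧ G.Adj x z) ∧ R y z then 1 else 0 := by
      intro x
      rw [Finset.sum_filter]
      apply Finset.sum_congr rfl
      intro y _
      split_ifs with hxy
      · rw [Finset.filter_filter, Finset.card_filter]
        simp [hxy]
      · simp [hxy]
    simp_rw [e1]
    rw [Finset.sum_comm, ← smul_eq_mul]
    apply Finset.sum_le_card_nsmul
    intro y _
    rw [Finset.sum_comm, ← smul_eq_mul]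
    apply Finset.sum_le_card_nsmul
    intro z _
    rw [← Finset.card_filter]
    by_cases hr : R y z
    · simp only [hr, and_true]
      exact ((hRd y z).1 hr).2.le
    · simp [hr]
  have h1 : ∑ x ∈ S, (S.filter (G.Adj x)).card ^ 2 ≤ s * (S.card * (S.card * b) + E) := by
    calc _ ≤ ∑ x ∈ S, s * ∑ y ∈ S.filter (G.Adj x),
          (((S.filter (G.Adj x)).filter (R y)).card + 1) := Finset.sum_le_sum key
      _ = s * (∑ x ∈ S, ∑ y ∈ S.filter (G.Adj x), ((S.filter (G.Adj x)).filter (R y)).card + E) := by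
          rw [← Finset.mul_sum]
          simp only [Finset.sum_add_distrib, Finset.sum_const, smul_eq_mul, mul_one, hEdef]
      _ ≤ _ := Nat.mul_le_mul_left _ (by omega)
  have h2 : E ^ 2 ≤ S.card * ∑ x ∈ S, (S.filter (G.Adj x)).card ^ 2 := by
    have := sq_sum_le_card_mul_sum_sq (s := S) (f := fun x => ((S.filter (G.Adj x)).card : ℤ))
    rw [hEdef]
    zify
    exact this
  have h3 : E ≤ S.card * S.card := by
    rw [hEdef]
    exact Finset.sum_le_card_nsmul _ _ _ (fun x _ => Finset.card_le_card (Finset.filter_subset _ _))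
  generalize S.card = n at *
  have h4 : E ^ 2 ≤ n ^ 3 * (s * (b + 1)) := by
    calc E ^ 2 ≤ n * (s * (n * (n * b) + n * n)) := by
          refine h2.trans (Nat.mul_le_mul_left _ (h1.trans (Nat.mul_le_mul_left _ ?_)))
          omega
      _ = _ := by ring
  have h5 : n ^ 4 ≤ n ^ 3 * (4 * r ^ 2 * (s * (b + 1))) := by
    calc n ^ 4 = (n ^ 2) ^ 2 := by ring
      _ ≤ (2 * r * E) ^ 2 := Nat.pow_le_pow_left hE 2
      _ = 4 * r ^ 2 * E ^ 2 := by ring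
      _ ≤ 4 * r ^ 2 * (n ^ 3 * (s * (b + 1))) := Nat.mul_le_mul_left _ h4
      _ = _ := by ring
  have hn0 : 0 < n := by omega
  have h6 : n ≤ 4 * r ^ 2 * (s * (b + 1)) := by
    have : n ^ 3 * n ≤ n ^ 3 * (4 * r ^ 2 * (s * (b + 1))) := by
      calc n ^ 3 * n = n ^ 4 := by ring
        _ ≤ _ := h5
    exact Nat.le_of_mul_le_mul_left this (by positivity)
  have h7 : s * (b + 1) ≤ 3 * s ^ 3 := by
    have : b + 1 ≤ 3 * s ^ 2 := by rw [hb]; nlinarith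
    calc s * (b + 1) ≤ s * (3 * s ^ 2) := Nat.mul_le_mul_left _ this
      _ = _ := by ring
  have h8 : 4 * r ^ 2 * (s * (b + 1)) ≤ 12 * r ^ 2 * s ^ 3 := by
    calc _ ≤ 4 * r ^ 2 * (3 * s ^ 3) := Nat.mul_le_mul_left _ h7
      _ = _ := by ring
  omega

lemma drc2 (G : SimpleGraph V) (S K : Finset V) (hK : K ⊆ S)
    (h : ∀ y ∈ K, ∀ z ∈ K, y ≠ z →
      K.card ^ 2 + K.card ≤ (S.filter (fun x => G.Adj x y ∧ G.Adj x z)).card) :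
    Mnr G S K.card := by
  let t : {p : V × V // p ∈ K.offDiag} → Finset V := fun p =>
    S.filter (fun x => G.Adj x p.1.1 ∧ G.Adj x p.1.2) \ K
  have hall : ∃ f : {p : V × V // p ∈ K.offDiag} → V, Function.Injective f ∧ ∀ p, f p ∈ t p := by
    apply (Finset.all_card_le_biUnion_card_iff_exists_injective t).1
    intro A
    rcases A.eq_empty_or_nonempty with rfl | ⟨p, hp⟩
    · simp
    have h1 : A.card ≤ K.offDiag.card := by
      have := Finset.card_le_univ A
      simpa using this
    have h2 : K.offDiag.card ≤ K.card ^ 2 := by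
      rw [Finset.offDiag_card, sq]; omega
    have h3 : K.card ^ 2 ≤ (t p).card := by
      have := Finset.mem_offDiag.1 p.2
      have h4 := h _ this.1 _ this.2.1 this.2.2
      have h5 := Finset.le_card_sdiff K (S.filter (fun x => G.Adj x p.1.1 ∧ G.Adj x p.1.2))
      show _ ≤ (S.filter (fun x => G.Adj x p.1.1 ∧ G.Adj x p.1.2) \ K).card
      omega
    have h4 : (t p).card ≤ (A.biUnion t).card :=
      Finset.card_le_card (Finset.subset_biUnion_of_mem t hp)
    omega
  obtain ⟨f, hf, hft⟩ := hall
  let w : V → V → V := fun y z => if hp : (y, z) ∈ K.offDiag then f ⟨(y, z), hp⟩ else y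
  have hw : ∀ y ∈ K, ∀ z ∈ K, y ≠ z → w y z ∈ S ∧ w y z ∉ K ∧ G.Adj y (w y z) ∧
      G.Adj (w y z) z := by
    intro y hy z hz hyz
    have hp : (y, z) ∈ K.offDiag := Finset.mem_offDiag.2 ⟨hy, hz, hyz⟩
    have := hft ⟨(y, z), hp⟩
    simp only [t, Finset.mem_sdiff, Finset.mem_filter] at this
    simp only [w, hp, dif_pos]
    exact ⟨this.1.1, this.2, this.1.2.1.symm, this.1.2.2⟩
  have hwi : ∀ y ∈ K, ∀ z ∈ K, y ≠ z → ∀ y' ∈ K, ∀ z' ∈ K, y' ≠ z' → w y z = w y' z' → y = y' := by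
    intro y hy z hz hyz y' hy' z' hz' hyz' e
    have hp : (y, z) ∈ K.offDiag := Finset.mem_offDiag.2 ⟨hy, hz, hyz⟩
    have hp' : (y', z') ∈ K.offDiag := Finset.mem_offDiag.2 ⟨hy', hz', hyz'⟩
    simp only [w, hp, hp', dif_pos] at e
    have := hf e
    simp at this
    exact this.1
  let T : V → Finset V := fun v => insert v ((K.erase v).image (w v))
  have hmem : ∀ v x, x ∈ T v ↔ x = v ∨ ∃ q ∈ K, v ≠ q ∧ w v q = x := by
    intro v x
    simp only [T, Finset.mem_insert, Finset.mem_image, Finset.mem_erase]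
    constructor
    · rintro (h | ⟨q, ⟨h1, h2⟩, h3⟩)
      · exact Or.inl h
      · exact Or.inr ⟨q, h2, h1.symm, h3⟩
    · rintro (h | ⟨q, h1, h2, h3⟩)
      · exact Or.inl h
      · exact Or.inr ⟨q, ⟨h2.symm, h1⟩, h3⟩
  have hdis : ∀ v ∈ K, ∀ v' ∈ K, v ≠ v' → Disjoint (T v) (T v') := by
    intro v hv v' hv' hne
    rw [Finset.disjoint_left]
    intro x hx hx'
    rw [hmem] at hx hx'
    rcases hx with e | ⟨q, q1, q2, e⟩ <;> rcases hx' with e' | ⟨q', q1', q2', e'⟩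
    · exact hne (e.symm.trans e')
    · exact (hw v' hv' q' q1' q2').2.1 (by rw [e', e]; exact hv)
    · exact (hw v hv q q1 q2).2.1 (by rw [e, e']; exact hv')
    · exact hne (hwi v hv q q1 q2 v' hv' q' q1' q2' (e.trans e'.symm))
  have hinj : Set.InjOn T K := by
    intro v hv v' hv' e
    by_contra hne
    have := hdis v hv v' hv' hne
    rw [← e] at this
    have hvT : v ∈ T v := (hmem v v).2 (Or.inl rfl)
    exact Finset.disjoint_left.1 this hvT hvT
  refine ⟨K.image T, Finset.card_image_of_injOn hinj, ?_, ?_⟩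
  · intro X hX
    obtain ⟨v, hv, rfl⟩ := Finset.mem_image.1 hX
    constructor
    · intro x hx
      rcases (hmem v x).1 hx with rfl | ⟨q, q1, q2, rfl⟩
      · exact hK hv
      · exact (hw v hv q q1 q2).1
    · apply conn_star
      intro x hx
      simp only [Finset.mem_image, Finset.mem_erase] at hx
      obtain ⟨q, ⟨q1, q2⟩, rfl⟩ := hx
      exact (hw v hv q q2 q1.symm).2.2.1
  · intro X hX Y hY hne
    obtain ⟨v, hv, rfl⟩ := Finset.mem_image.1 hX
    obtain ⟨v', hv', rfl⟩ := Finset.mem_image.1 hY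
    have hvv : v ≠ v' := fun e => hne (by rw [e])
    refine ⟨hdis v hv v' hv' hvv, w v v', (hmem _ _).2 (Or.inr ⟨v', hv', hvv, rfl⟩), v',
      (hmem _ _).2 (Or.inl rfl), (hw v hv v' hv' hvv).2.2.2⟩

lemma drc (G : SimpleGraph V) (S : Finset V) (r s : ℕ)
    (hE : S.card ^ 2 ≤ 2 * r * ∑ x ∈ S, (S.filter (G.Adj x)).card)
    (hn : 12 * r ^ 2 * s ^ 3 < S.card) : Mnr G S s := by
  rcases Nat.eq_zero_or_pos s with rfl | hs
  · exact ⟨∅, by simp, by simp, by simp⟩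
  obtain ⟨I, h1, h2, h3⟩ := drc1 G S r s hs hE hn
  obtain ⟨K, hKI, hKc⟩ := Finset.exists_subset_card_eq h2
  have := drc2 G S K (hKI.trans h1) (fun y hy z hz hyz => by
    rw [hKc]; exact h3 y (hKI hy) z (hKI hz) hyz)
  rwa [hKc] at this

noncomputable def L : ℝ := 1000 / 513

lemma deg_bound (G : SimpleGraph V) (S : Finset V) (k : ℕ) (q : ℝ) (hk : Bd G S k) (hk1 : 1 ≤ k)
    (hq : ∀ I ⊆ S, Ind G I → (I.card : ℝ) ≤ q)
    (hD : ∀ D ⊆ S, D.Nonempty → Dom G S D → CC G S D → L * q < D.card) :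
    ∀ x ∈ S, ((S.filter (G.Adj x)).card : ℝ) ≤ ((k : ℝ) - 1) * (2 * (2 - L) * q + 1) := by
  intro x hx
  have hq0 : 0 ≤ q := by
    have := hq ∅ (by simp) (by intro u hu; simp at hu)
    simpa using this
  set U := S.filter (G.Adj x) with hU
  have hUS : U ⊆ S := Finset.filter_subset _ _
  have hL2 : (0 : ℝ) ≤ 2 - L := by unfold L; norm_num
  have hnn : 0 ≤ (2 - L) * q := mul_nonneg hL2 hq0
  set a := Nat.floor ((2 - L) * q + 1) with ha
  have hal : (a : ℝ) ≤ (2 - L) * q + 1 := Nat.floor_le (by linarith)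
  have ha1 : 1 ≤ a := Nat.le_floor (by push_cast; linarith)
  have hI : ∀ I ⊆ U, Ind G I → I.card ≤ a := by
    intro I hIU hI
    rcases I.eq_empty_or_nonempty with rfl | hIn
    · simp
    have hm := hIn.card_pos
    have hadj : ∀ v ∈ I, G.Adj x v := fun v hv => (Finset.mem_filter.1 (hIU hv)).2
    have hxI : x ∉ I := fun h => G.loopless.irrefl _ (hadj x h)
    obtain ⟨D, I', d1, d2, d3, d4, d5, d6⟩ := dm_ext G S (I.card - 1) _ (insert x I) I le_rfl
      (Finset.insert_subset hx (hIU.trans hUS)) (Finset.subset_insert _ _) hI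
      (by rw [Finset.card_insert_of_notMem hxI]; omega) (cc_of_conn (conn_star x hadj))
    have hDn : D.Nonempty := by
      by_contra hne
      rw [Finset.not_nonempty_iff_eq_empty] at hne
      obtain ⟨d, hd, _⟩ := d6 x hx (by simp [hne])
      simp [hne] at hd
    have e1 := hD D d1 hDn d6 d5
    have e2 := hq I' (d2.trans d1) d3
    have e3 : (D.card : ℝ) + (I.card - 1) ≤ 2 * I'.card := by
      have : D.card + I.card ≤ 2 * I'.card + 1 := by omega
      have : ((D.card + I.card : ℕ) : ℝ) ≤ ((2 * I'.card + 1 : ℕ) : ℝ) := by exact_mod_cast this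
      push_cast at this
      linarith
    apply Nat.le_floor
    linarith
  have hb : Bd G U (k - 1) := by
    have hW : Bd G (insert x U) k := hk.mono (Finset.insert_subset hx hUS)
    have := hW.drop (D := {x}) (by simp) (by simp) (by
      intro v hv hvx
      simp at hv hvx
      rcases hv with h | h
      · exact absurd h hvx
      · exact ⟨x, by simp, (Finset.mem_filter.1 h).2⟩) (cc_of_conn (conn_singleton G x))
    refine this.mono ?_
    intro v hv
    have : v ≠ x := fun e => G.loopless.irrefl x (e ▸ (Finset.mem_filter.1 hv).2)
    simp [hv, this]
  have h1 := duchet_meyniel G a (k - 1) U hb hI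
  have h2 : (U.card : ℝ) ≤ ((k - 1 : ℕ) : ℝ) * ((2 * a - 1 : ℕ) : ℝ) := by exact_mod_cast h1
  rw [Nat.cast_sub hk1, Nat.cast_sub (by omega)] at h2
  push_cast at h2
  refine h2.trans (mul_le_mul_of_nonneg_left (by linarith) ?_)
  have : (1 : ℝ) ≤ k := by exact_mod_cast hk1
  linarith

variable {ι : Type*} [DecidableEq ι]

lemma sum_le_prod (A : Finset ι) (k : ι → ℕ) (h : ∀ i ∈ A, 1 ≤ k i) :
    1 + ∑ i ∈ A, ((k i : ℝ) - 1) ≤ ∏ i ∈ A, (k i : ℝ) := by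
  induction A using Finset.induction_on with
  | empty => simp
  | insert a s ha ih =>
    rw [Finset.sum_insert ha, Finset.prod_insert ha]
    have h1 := ih (fun i hi => h i (by simp [hi]))
    have h2 : (1 : ℝ) ≤ k a := by exact_mod_cast h a (by simp)
    have h3 : 0 ≤ ∑ i ∈ s, ((k i : ℝ) - 1) := Finset.sum_nonneg (fun i hi => by
      have : (1 : ℝ) ≤ k i := by exact_mod_cast h i (by simp [hi])
      linarith)
    nlinarith

lemma pow_le_prod (A : Finset ι) (k : ι → ℕ) (h : ∀ i ∈ A, 2 ≤ k i) :
    (2 : ℝ) ^ A.card ≤ ∏ i ∈ A, (k i : ℝ) := by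
  rw [← Finset.prod_const]
  apply Finset.prod_le_prod
  · intros; norm_num
  · intro i hi; exact_mod_cast h i hi

lemma num_bound (m : ℕ) : 81 * ((m : ℝ) + 10) ^ 2 ≤ (2 * L) ^ (m + 8) := by
  have hL : (3.8 : ℝ) ≤ 2 * L := by unfold L; norm_num
  induction m with
  | zero =>
    have : (3.8 : ℝ) ^ 8 ≤ (2 * L) ^ 8 := pow_le_pow_left₀ (by norm_num) hL 8
    norm_num at this ⊢
    linarith
  | succ m ih =>
    have h0 : (0 : ℝ) ≤ m := Nat.cast_nonneg m
    rw [show m + 1 + 8 = (m + 8) + 1 by ring, pow_succ (2 * L)]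
    have h1 : 0 ≤ (2 * L) ^ (m + 8) := by
      have : (0 : ℝ) ≤ 2 * L := by linarith
      positivity
    have h2 : (2 * L) ^ (m + 8) * 3.8 ≤ (2 * L) ^ (m + 8) * (2 * L) :=
      mul_le_mul_of_nonneg_left hL h1
    push_cast
    nlinarith

def Main (G : ι → SimpleGraph V) (A : Finset ι) : Prop :=
  ∀ (S : Finset V) (k : ι → ℕ), (∀ i ∈ A, Bd (G i) S (k i)) →
    (∀ u ∈ S, ∀ v ∈ S, u ≠ v → ∃ i ∈ A, (G i).Adj u v) →
    (S.card : ℝ) ≤ L ^ (A.card - 2) * ∏ i ∈ A, (k i : ℝ)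

lemma big_case (G : ι → SimpleGraph V) (A : Finset ι) (S : Finset V) (k : ι → ℕ) (T P : ℝ)
    (hA : 10 ≤ A.card) (hk : ∀ i ∈ A, 2 ≤ k i) (hP : P = ∏ i ∈ A, (k i : ℝ))
    (hT : T = L ^ (A.card - 3) * P) (hPT : P ≤ T)
    (hn : L * T < S.card) (hbd : ∀ i ∈ A, Bd (G i) S (k i))
    (hcov : ∀ x ∈ S, (S.card : ℝ) - 1 ≤ ∑ i ∈ A, ((S.filter ((G i).Adj x)).card : ℝ))
    (hdeg : ∀ i ∈ A, ∀ x ∈ S, ((S.filter ((G i).Adj x)).card : ℝ) ≤ 2 * (2 - L) * T + k i - 1) :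
    False := by
  set n := (S.card : ℝ) with hndef
  set r := (A.card : ℝ) with hrdef
  have hr : (10 : ℝ) ≤ r := by rw [hrdef]; exact_mod_cast hA
  have hP10 : (1024 : ℝ) ≤ P := by
    have h1 := pow_le_prod A k hk
    have h2 : (2 : ℝ) ^ 10 ≤ 2 ^ A.card := pow_le_pow_right₀ (by norm_num) hA
    norm_num at h2
    rw [hP]; linarith
  have hkT : ∀ i ∈ A, (k i : ℝ) * 512 ≤ T := by
    intro i hi
    have h1 : (k i : ℝ) * ∏ j ∈ A.erase i, (k j : ℝ) = P := by
      rw [hP]; exact Finset.mul_prod_erase A (fun j => (k j : ℝ)) hi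
    have h2 := pow_le_prod (A.erase i) k (fun j hj => hk j (Finset.mem_of_mem_erase hj))
    have h3 : (2 : ℝ) ^ 9 ≤ 2 ^ (A.erase i).card := pow_le_pow_right₀ (by norm_num) (by
      rw [Finset.card_erase_of_mem hi]; omega)
    norm_num at h3
    have h4 : (0 : ℝ) ≤ k i := Nat.cast_nonneg _
    nlinarith
  have hL : L = 1000 / 513 := rfl
  have hnT : T * 1.949 ≤ n := by
    rw [hL] at hn
    norm_num at hn ⊢
    linarith
  have hd18 : ∀ i ∈ A, ∀ x ∈ S, ((S.filter ((G i).Adj x)).card : ℝ) ≤ n / 18 := by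
    intro i hi x hx
    have h1 := hdeg i hi x hx
    have h2 := hkT i hi
    rw [hL] at h1
    norm_num at h1 hnT
    linarith
  let E : ι → ℝ := fun i => ∑ x ∈ S, ((S.filter ((G i).Adj x)).card : ℝ)
  have hE18 : ∀ i ∈ A, E i ≤ n * (n / 18) := by
    intro i hi
    have := Finset.sum_le_card_nsmul S (fun x => ((S.filter ((G i).Adj x)).card : ℝ)) (n / 18)
      (hd18 i hi)
    simpa [nsmul_eq_mul] using this
  have hEsum : n * (n - 1) ≤ ∑ i ∈ A, E i := by
    have := Finset.card_nsmul_le_sum S (fun x => ∑ i ∈ A, ((S.filter ((G i).Adj x)).card : ℝ))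
      (n - 1) hcov
    rw [nsmul_eq_mul, Finset.sum_comm] at this
    exact this
  obtain ⟨B, hB⟩ : ∃ B, B = A.filter (fun i => n ^ 2 ≤ 2 * r * E i) := ⟨_, rfl⟩
  have hn1024 : 1024 ≤ n := by nlinarith
  have hB3 : 3 ≤ B.card := by
    by_contra hlt
    have hlt' : B.card ≤ 2 := by omega
    have hsplit : ∑ i ∈ A, E i = ∑ i ∈ B, E i +
        ∑ i ∈ A.filter (fun i => ¬ n ^ 2 ≤ 2 * r * E i), E i := by
      rw [hB]; exact (Finset.sum_filter_add_sum_filter_not A _ _).symm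
    have s1 : ∑ i ∈ B, E i ≤ 2 * (n * (n / 18)) := by
      have := Finset.sum_le_card_nsmul B E (n * (n / 18)) (fun i hi => hE18 i (by
        rw [hB] at hi; exact (Finset.mem_filter.1 hi).1))
      rw [nsmul_eq_mul] at this
      have h3 : (B.card : ℝ) ≤ 2 := by exact_mod_cast hlt'
      have h4 : 0 ≤ n * (n / 18) := by positivity
      nlinarith
    have s2 : ∑ i ∈ A.filter (fun i => ¬ n ^ 2 ≤ 2 * r * E i), E i ≤ n ^ 2 / 2 := by
      have := Finset.sum_le_card_nsmul (A.filter (fun i => ¬ n ^ 2 ≤ 2 * r * E i)) E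
        (n ^ 2 / (2 * r)) (fun i hi => by
          have := (Finset.mem_filter.1 hi).2
          push Not at this
          rw [le_div_iff₀ (by linarith)]
          linarith)
      rw [nsmul_eq_mul] at this
      have h3 : ((A.filter (fun i => ¬ n ^ 2 ≤ 2 * r * E i)).card : ℝ) ≤ r := by
        rw [hrdef]
        exact Nat.cast_le.2 <| Finset.card_le_card (Finset.filter_subset _ _)
      have h4 : 0 ≤ n ^ 2 / (2 * r) := by positivity
      have h5 : r * (n ^ 2 / (2 * r)) = n ^ 2 / 2 := by field_simp
      nlinarith
    nlinarith
  have hBk : ∀ i ∈ B, n ≤ 40.5 * r ^ 2 * (k i : ℝ) ^ 3 := by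
    intro i hi
    rw [hB, Finset.mem_filter] at hi
    have hE : S.card ^ 2 ≤ 2 * A.card * ∑ x ∈ S, (S.filter ((G i).Adj x)).card := by
      have := hi.2
      simp only [E, hndef, hrdef] at this
      exact_mod_cast this
    have h1 : ¬ 12 * A.card ^ 2 * (k i + 1) ^ 3 < S.card := by
      intro hlt
      have := hbd i hi.1 _ (drc (G i) S A.card (k i + 1) hE hlt)
      omega
    push Not at h1
    have h2 : n ≤ 12 * r ^ 2 * ((k i : ℝ) + 1) ^ 3 := by
      rw [hndef, hrdef]; exact_mod_cast h1
    have h3 : ((k i : ℝ) + 1) ^ 3 ≤ (1.5 * k i) ^ 3 := by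
      have : (2 : ℝ) ≤ k i := by exact_mod_cast hk i hi.1
      apply pow_le_pow_left₀ (by positivity)
      linarith
    calc n ≤ 12 * r ^ 2 * ((k i : ℝ) + 1) ^ 3 := h2
      _ ≤ 12 * r ^ 2 * (1.5 * k i) ^ 3 := mul_le_mul_of_nonneg_left h3 (by positivity)
      _ = _ := by ring
  obtain ⟨C, hC, hC3⟩ := Finset.exists_subset_card_eq hB3
  have hCA : C ⊆ A := hC.trans (by rw [hB]; exact Finset.filter_subset _ _)
  have hprod : n ^ 3 ≤ (40.5 * r ^ 2 * ∏ i ∈ C, (k i : ℝ)) ^ 3 := by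
    have : ∏ i ∈ C, n ≤ ∏ i ∈ C, (40.5 * r ^ 2 * (k i : ℝ) ^ 3) :=
      Finset.prod_le_prod (fun _ _ => by linarith) (fun i hi => hBk i (hC hi))
    rw [Finset.prod_const, hC3, Finset.prod_mul_distrib, Finset.prod_const, hC3,
      Finset.prod_pow] at this
    rwa [mul_pow]
  have hpc0 : 0 ≤ ∏ i ∈ C, (k i : ℝ) := Finset.prod_nonneg (fun _ _ => Nat.cast_nonneg _)
  have hfin1 : n ≤ 40.5 * r ^ 2 * ∏ i ∈ C, (k i : ℝ) :=
    le_of_pow_le_pow_left₀ (by norm_num) (by positivity) hprod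
  have hPge : (2 : ℝ) ^ (A.card - 3) * ∏ i ∈ C, (k i : ℝ) ≤ P := by
    rw [hP, ← Finset.prod_sdiff hCA]
    apply mul_le_mul_of_nonneg_right _ hpc0
    have := pow_le_prod (A \ C) k (fun i hi => hk i (Finset.mem_sdiff.1 hi).1)
    rwa [Finset.card_sdiff_of_subset hCA, hC3] at this
  obtain ⟨m, hm⟩ : ∃ m, A.card = m + 10 := ⟨A.card - 10, by omega⟩
  have hnum := num_bound m
  have hrm : r = m + 10 := by rw [hrdef, hm]; push_cast; ring
  have e1 : A.card - 3 = m + 7 := by omega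
  rw [e1] at hT hPge
  have hL0 : 0 < L := by rw [hL]; norm_num
  have hfin2 : L ^ (m + 8) * 2 ^ (m + 7) * ∏ i ∈ C, (k i : ℝ) < n := by
    calc L ^ (m + 8) * 2 ^ (m + 7) * ∏ i ∈ C, (k i : ℝ)
        = L ^ (m + 8) * (2 ^ (m + 7) * ∏ i ∈ C, (k i : ℝ)) := by ring
      _ ≤ L ^ (m + 8) * P := mul_le_mul_of_nonneg_left hPge (by positivity)
      _ = L * T := by rw [hT]; ring
      _ < n := hn
  have hfin3 : 40.5 * r ^ 2 ≤ L ^ (m + 8) * 2 ^ (m + 7) := by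
    have : L ^ (m + 8) * 2 ^ (m + 7) * 2 = (2 * L) ^ (m + 8) := by rw [mul_pow]; ring
    rw [hrm]
    linarith
  have := mul_le_mul_of_nonneg_right hfin3 hpc0
  linarith

lemma main_step (G : ι → SimpleGraph V) (A : Finset ι) (hA : 3 ≤ A.card)
    (ih : ∀ i ∈ A, Main G (A.erase i)) : Main G A := by
  suffices H : ∀ (N : ℕ) (S : Finset V) (k : ι → ℕ), S.card ≤ N → (∀ i ∈ A, Bd (G i) S (k i)) →
    (∀ u ∈ S, ∀ v ∈ S, u ≠ v → ∃ i ∈ A, (G i).Adj u v) →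
    (S.card : ℝ) ≤ L ^ (A.card - 2) * ∏ i ∈ A, (k i : ℝ) from fun S k => H _ S k le_rfl
  intro N
  have hL : L = 1000 / 513 := rfl
  have hL1 : 1 ≤ L := by rw [hL]; norm_num
  have hL0 : 0 < L := by linarith
  induction N with
  | zero =>
    intro S k h _ _
    have : S.card = 0 := by omega
    rw [this]
    have : 0 ≤ ∏ i ∈ A, (k i : ℝ) := Finset.prod_nonneg (fun _ _ => Nat.cast_nonneg _)
    push_cast
    positivity
  | succ N ihN =>
    intro S k hN hbd hcov
    by_contra hlt
    push Not at hlt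
    have hP0 : 0 ≤ ∏ i ∈ A, (k i : ℝ) := Finset.prod_nonneg (fun _ _ => Nat.cast_nonneg _)
    have hS : S.Nonempty := by
      rw [Finset.nonempty_iff_ne_empty]
      rintro rfl
      simp at hlt
      have : 0 ≤ L ^ (A.card - 2) * ∏ i ∈ A, (k i : ℝ) := by positivity
      linarith
    have hk1 : ∀ i ∈ A, 1 ≤ k i := fun i hi => (hbd i hi).pos hS
    set P := ∏ i ∈ A, (k i : ℝ) with hP
    let Q : ι → ℝ := fun i => ∏ j ∈ A.erase i, (k j : ℝ)
    have hQ0 : ∀ i, 0 ≤ Q i := fun i => Finset.prod_nonneg (fun _ _ => Nat.cast_nonneg _)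
    have hQP : ∀ i ∈ A, (k i : ℝ) * Q i = P := fun i hi =>
      Finset.mul_prod_erase A (fun j => (k j : ℝ)) hi
    have hcard : ∀ i ∈ A, (A.erase i).card - 2 = A.card - 3 := by
      intro i hi; rw [Finset.card_erase_of_mem hi]; omega
    have hpow : L ^ (A.card - 2) = L * L ^ (A.card - 3) := by
      rw [← pow_succ']; congr 1; omega
    -- independent sets
    have hind : ∀ i ∈ A, ∀ I ⊆ S, Ind (G i) I → (I.card : ℝ) ≤ L ^ (A.card - 3) * Q i := by
      intro i hi I hI hInd
      have := ih i hi I k (fun j hj => (hbd j (Finset.mem_of_mem_erase hj)).mono hI) (by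
        intro u hu v hv hne
        obtain ⟨j, hj, ha⟩ := hcov u (hI hu) v (hI hv) hne
        refine ⟨j, Finset.mem_erase.2 ⟨?_, hj⟩, ha⟩
        rintro rfl
        exact hInd u hu v hv ha)
      rwa [hcard i hi] at this
    have hLp : 0 < L ^ (A.card - 3) := by positivity
    have hk2 : ∀ i ∈ A, 2 ≤ k i := by
      intro i hi
      by_contra h
      have h1 : k i = 1 := by have := hk1 i hi; omega
      have h2 := hbd i hi
      rw [h1] at h2
      have h3 := hind i hi S le_rfl (no_adj_of_bd_one h2)
      have h4 := hQP i hi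
      rw [h1] at h4
      simp at h4
      rw [h4] at h3
      rw [hpow] at hlt
      have : L ^ (A.card - 3) * P ≤ L * (L ^ (A.card - 3) * P) :=
        le_mul_of_one_le_left (by positivity) hL1
      linarith
    set T := L ^ (A.card - 3) * P with hT
    have hn : L * T < S.card := by rw [hT, ← mul_assoc, ← hpow]; exact hlt
    have hPT : P ≤ T := by
      rw [hT]; exact le_mul_of_one_le_left hP0 (one_le_pow₀ hL1)
    have hdom : ∀ i ∈ A, ∀ D ⊆ S, D.Nonempty → Dom (G i) S D → CC (G i) S D →
        L * (L ^ (A.card - 3) * Q i) < D.card := by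
      intro i hi D hD hDn hdom hcc
      have hc := Finset.card_sdiff_add_card_eq_card hD
      have hc2 := hDn.card_pos
      have h1 := ihN (S \ D) (Function.update k i (k i - 1)) (by omega) (by
        intro j hj
        by_cases hji : j = i
        · subst hji
          rw [Function.update_self]
          exact (hbd j hj).drop hS hD hdom hcc
        · rw [Function.update_of_ne hji]
          exact (hbd j hj).mono Finset.sdiff_subset)
        (fun u hu v hv => hcov u (Finset.mem_sdiff.1 hu).1 v (Finset.mem_sdiff.1 hv).1)
      have h2 : ∏ j ∈ A, ((Function.update k i (k i - 1) j : ℕ) : ℝ) = ((k i : ℝ) - 1) * Q i := by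
        rw [← Finset.mul_prod_erase A _ hi, Function.update_self, Nat.cast_sub (hk1 i hi)]
        push_cast
        congr 1
        apply Finset.prod_congr rfl
        intro j hj
        rw [Function.update_of_ne (Finset.ne_of_mem_erase hj)]
      rw [h2, hpow] at h1
      have h3 : ((S \ D).card : ℝ) + D.card = S.card := by exact_mod_cast hc
      have h4 : L * T = L * L ^ (A.card - 3) * ((k i : ℝ) * Q i) := by
        rw [hT, hQP i hi]; ring
      have h5 : L * L ^ (A.card - 3) * ((k i : ℝ) * Q i) =
        L * L ^ (A.card - 3) * (((k i : ℝ) - 1) * Q i) + L * (L ^ (A.card - 3) * Q i) := by ring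
      linarith
    have hdeg : ∀ i ∈ A, ∀ x ∈ S,
        ((S.filter ((G i).Adj x)).card : ℝ) ≤ 2 * (2 - L) * T + k i - 1 := by
      intro i hi x hx
      have h1 := deg_bound (G i) S (k i) _ (hbd i hi) (hk1 i hi) (hind i hi) (hdom i hi) x hx
      have h2 : T = (k i : ℝ) * (L ^ (A.card - 3) * Q i) := by
        rw [hT, ← hQP i hi]; ring
      have h3 : 0 ≤ L ^ (A.card - 3) * Q i := mul_nonneg hLp.le (hQ0 i)
      have h4 : 0 ≤ 2 * (2 - L) := by rw [hL]; norm_num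
      rw [h2]
      nlinarith [mul_nonneg h4 h3]
    have hcv : ∀ x ∈ S, (S.card : ℝ) - 1 ≤ ∑ i ∈ A, ((S.filter ((G i).Adj x)).card : ℝ) := by
      intro x hx
      have h1 : S.erase x ⊆ A.biUnion (fun i => S.filter ((G i).Adj x)) := by
        intro y hy
        obtain ⟨hyx, hyS⟩ := Finset.mem_erase.1 hy
        obtain ⟨i, hi, ha⟩ := hcov x hx y hyS hyx.symm
        exact Finset.mem_biUnion.2 ⟨i, hi, Finset.mem_filter.2 ⟨hyS, ha⟩⟩
      have h2 := (Finset.card_le_card h1).trans Finset.card_biUnion_le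
      rw [Finset.card_erase_of_mem hx] at h2
      have h3 : S.card ≤ (∑ i ∈ A, (S.filter ((G i).Adj x)).card) + 1 := by omega
      have h4 : (S.card : ℝ) ≤ (∑ i ∈ A, ((S.filter ((G i).Adj x)).card : ℝ)) + 1 := by
        exact_mod_cast h3
      linarith
    by_cases h10 : 10 ≤ A.card
    · exact big_case G A S k T P h10 hk2 hP hT hPT hn hbd hcv hdeg
    · obtain ⟨x, hx⟩ := hS
      have h1 := hcv x hx
      have h2 : ∑ i ∈ A, ((S.filter ((G i).Adj x)).card : ℝ) ≤
          ∑ i ∈ A, (2 * (2 - L) * T + ((k i : ℝ) - 1)) :=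
        Finset.sum_le_sum (fun i hi => by linarith [hdeg i hi x hx])
      rw [Finset.sum_add_distrib, Finset.sum_const, nsmul_eq_mul] at h2
      have h3 := sum_le_prod A k hk1
      have h4 : (A.card : ℝ) ≤ 9 := by
        have : A.card ≤ 9 := by omega
        exact_mod_cast this
      have hP1 : 1 ≤ P := by
        rw [hP]
        exact_mod_cast Finset.one_le_prod' (f := k) hk1
      have h5 : (A.card : ℝ) * (2 * (2 - L) * T) ≤ 9 * (2 * (2 - L) * T) := by
        apply mul_le_mul_of_nonneg_right h4
        have : 0 ≤ 2 * (2 - L) := by rw [hL]; norm_num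
        have : 0 ≤ T := by linarith
        positivity
      have h6 : (S.card : ℝ) ≤ 18 * (2 - L) * T + T := by linarith
      rw [hL] at h6 hn
      have : 0 < T := by linarith
      linarith

theorem main (G : ι → SimpleGraph V) : ∀ (c : ℕ) (A : Finset ι), A.card = c → Main G A := by
  intro c
  induction c with
  | zero =>
    intro A hA S k _ hcov
    rw [Finset.card_eq_zero] at hA
    subst hA
    have : S.card ≤ 1 := by
      rw [Finset.card_le_one]
      intro u hu v hv
      by_contra hne
      obtain ⟨i, hi, _⟩ := hcov u hu v hv hne
      simp at hi
    simpa using this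
  | succ c ih =>
    intro A hA
    by_cases h3 : 3 ≤ A.card
    · exact main_step G A h3 (fun i hi => ih _ (by rw [Finset.card_erase_of_mem hi]; omega))
    intro S k hbd hcov
    have : A.card = 1 ∨ A.card = 2 := by omega
    rcases this with h1 | h2
    · obtain ⟨i, rfl⟩ := Finset.card_eq_one.1 h1
      have := hbd i (by simp) _ (mnr_clique (G := G i) (K := S) le_rfl (fun u hu v hv hne => by
        obtain ⟨j, hj, ha⟩ := hcov u hu v hv hne
        simp at hj
        exact hj ▸ ha))
      simpa using this
    · obtain ⟨i, j, hij, rfl⟩ := Finset.card_eq_two.1 h2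
      have := two_color _ (G i) (G j) S (k i) (k j) le_rfl (hbd i (by simp)) (hbd j (by simp))
        (fun u hu v hv hne => by
          obtain ⟨l, hl, ha⟩ := hcov u hu v hv hne
          simp at hl
          rcases hl with e | e
          · left; exact e ▸ ha
          · right; exact e ▸ ha)
      rw [h2, Finset.prod_pair hij]
      simp
      exact_mod_cast this

lemma minor_le {n : ℕ} (G : SimpleGraph (Fin n)) (C : Finset (Fin n))
    (h1 : ∀ u v, u ∉ C → v ∉ C → ¬ G.Adj u v) (h2 : ∀ z, z ∉ C → ∃ c ∈ C, ¬ G.Adj z c)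
    (m : ℕ) (hm : NG.HasCliqueMinor G m) : m ≤ C.card := by
  obtain ⟨B, b1, b2, b3, b4⟩ := hm
  have inj : ∀ p q x, x ∈ B p → x ∈ B q → p = q := by
    intro p q x hp hq
    by_contra hne
    exact Finset.disjoint_left.1 (b3 p q hne) hp hq
  by_cases hall : ∀ p, ∃ x ∈ C, x ∈ B p
  · choose f hf1 hf2 using hall
    have := Finset.card_le_card_of_injOn (s := Finset.univ) (t := C) f (fun p _ => hf1 p)
      (fun p _ q _ e => inj p q (f p) (hf2 p) (e ▸ hf2 q))
    simpa using this
  · push Not at hall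
    obtain ⟨p0, hp0⟩ := hall
    obtain ⟨z, hz⟩ := b1 p0
    have hzC : z ∉ C := fun h => hp0 z h hz
    have hsing : ∀ w ∈ B p0, w = z := by
      intro w hw
      by_contra hne
      obtain ⟨x, hx, y, hy, _, _, ha⟩ := Conn.cross (G := G) (b2 p0) (fun t => t = z) hz hw rfl hne
      exact h1 x y (fun h => hp0 x h hx) (fun h => hp0 y h hy) ha
    obtain ⟨c, hc, hcz⟩ := h2 z hzC
    have hq : ∀ q, ∃ x, q ≠ p0 → x ∈ C.erase c ∧ x ∈ B q := by
      intro q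
      by_cases hqp : q = p0
      · exact ⟨z, fun h => absurd hqp h⟩
      obtain ⟨u, hu, v, hv, ha⟩ := b4 p0 q (Ne.symm hqp)
      have := hsing u hu
      subst this
      refine ⟨v, fun _ => ⟨Finset.mem_erase.2 ⟨?_, ?_⟩, hv⟩⟩
      · rintro rfl
        exact hcz ha
      · by_contra hvC
        exact h1 u v hzC hvC ha
    choose f hf using hq
    have := Finset.card_le_card_of_injOn (s := Finset.univ.erase p0) (t := C.erase c) f
      (fun p hp => (hf p (Finset.ne_of_mem_erase hp)).1)
      (fun p hp q hq e => inj p q (f p) (hf p (Finset.ne_of_mem_erase hp)).2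
        (e ▸ (hf q (Finset.ne_of_mem_erase hq)).2))
    rw [Finset.card_erase_of_mem (Finset.mem_univ _), Finset.card_erase_of_mem hc,
      Finset.card_univ, Fintype.card_fin] at this
    have hcp : 0 < C.card := Finset.card_pos.2 ⟨c, hc⟩
    omega

lemma had_le {n : ℕ} (G : SimpleGraph (Fin n)) (C : Finset (Fin n))
    (h1 : ∀ u v, u ∉ C → v ∉ C → ¬ G.Adj u v) (h2 : ∀ z, z ∉ C → ∃ c ∈ C, ¬ G.Adj z c) :
    NG.hadwiger n G ≤ C.card :=
  csSup_le' (fun m hm => minor_le G C h1 h2 m hm)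

lemma bd_had {n : ℕ} (G : SimpleGraph (Fin n)) : Bd G Finset.univ (NG.hadwiger n G) := by
  intro m hm
  apply le_csSup
  · refine ⟨(Finset.univ : Finset (Fin n)).card, fun m hm => ?_⟩
    exact minor_le G Finset.univ (by simp) (by simp) m hm
  · obtain ⟨F, f1, f2, f3⟩ := hm
    subst f1
    let e := F.equivFin.symm
    have hne : ∀ p q, p ≠ q → (e p).1 ≠ (e q).1 := fun p q hpq h =>
      hpq (e.injective (Subtype.ext h))
    exact ⟨fun p => (e p).1, fun p => (f2 _ (e p).2).2.nonempty, fun p => (f2 _ (e p).2).2,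
      fun p q hpq => (f3 _ (e p).2 _ (e q).2 (hne p q hpq)).1,
      fun p q hpq => (f3 _ (e p).2 _ (e q).2 (hne p q hpq)).2⟩

/-- The colouring used in the construction (for `u < v`). -/
def col (s u v : ℕ) : ℕ :=
  if 2 * s ≤ u then s
  else if v < 2 * s then
    (if u / 2 = v / 2 then u / 2 else if u % 2 = v % 2 then u / 2 else v / 2)
  else if v = 2 * s then (if u % 2 = 0 then u / 2 else s)
  else (if u % 2 = 1 then u / 2 else s)

lemma col_le (s u v : ℕ) : col s u v ≤ s := by
  unfold col
  split_ifs <;> omega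

lemma col_out {s u v i : ℕ} (hi : i < s) (hu : u / 2 ≠ i) (hv : v / 2 ≠ i) :
    col s u v ≠ i := by
  unfold col
  split_ifs <;> omega

lemma col_out' {s u v : ℕ} (hu : u < 2 * s) (hv : v < 2 * s) :
    col s u v ≠ s := by
  unfold col
  split_ifs <;> omega

def cg (n s i : ℕ) : SimpleGraph (Fin n) where
  Adj u v := u ≠ v ∧ col s (min u.1 v.1) (max u.1 v.1) = i
  symm := ⟨by
    rintro u v ⟨h1, h2⟩
    exact ⟨h1.symm, by rwa [min_comm, max_comm]⟩⟩
  loopless := ⟨fun u h => h.1 rfl⟩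

lemma cg_adj {n s i : ℕ} {u v : Fin n} : (cg n s i).Adj u v ↔
    u ≠ v ∧ col s (min u.1 v.1) (max u.1 v.1) = i := Iff.rfl

lemma cg_had_small {n s i : ℕ} (hi : i < s) (hn : 2 * s + 2 ≤ n) :
    NG.hadwiger n (cg n s i) ≤ 2 := by
  have ha : 2 * i < n := by omega
  have hb : 2 * i + 1 < n := by omega
  have hmem : ∀ u : Fin n, u ∉ ({⟨2 * i, ha⟩, ⟨2 * i + 1, hb⟩} : Finset (Fin n)) → u.1 / 2 ≠ i := by
    intro u hu h
    simp [Fin.ext_iff] at hu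
    omega
  refine (had_le _ {⟨2 * i, ha⟩, ⟨2 * i + 1, hb⟩} ?_ ?_).trans Finset.card_le_two
  · intro u v hu hv hadj
    have h1 := hmem u hu
    have h2 := hmem v hv
    refine col_out hi ?_ ?_ hadj.2
    · rcases min_choice u.1 v.1 with e | e <;> rw [e] <;> assumption
    · rcases max_choice u.1 v.1 with e | e <;> rw [e] <;> assumption
  · intro z hz
    have h1 := hmem z hz
    have key : col s (min z.1 (2 * i)) (max z.1 (2 * i)) ≠ i ∨
        col s (min z.1 (2 * i + 1)) (max z.1 (2 * i + 1)) ≠ i := by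
      rcases Nat.lt_or_ge z.1 (2 * i) with h | h
      · rw [min_eq_left (by omega), max_eq_right (by omega), min_eq_left (by omega),
          max_eq_right (by omega)]
        by_cases hp : z.1 % 2 = 0
        · left
          unfold col
          split_ifs <;> omega
        · right
          unfold col
          split_ifs <;> omega
      · rw [min_eq_right (by omega), max_eq_left (by omega), min_eq_right (by omega),
          max_eq_left (by omega)]
        rcases lt_trichotomy z.1 (2 * s) with h2 | h2 | h2
        · by_cases hp : z.1 % 2 = 0
          · right
            unfold col
            split_ifs <;> omega
          · left
            unfold col
            split_ifs <;> omega
        · right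
          unfold col
          split_ifs <;> omega
        · left
          unfold col
          split_ifs <;> omega
    rcases key with h | h
    · exact ⟨⟨2 * i, ha⟩, by simp, fun hadj => h hadj.2⟩
    · exact ⟨⟨2 * i + 1, hb⟩, by simp, fun hadj => h hadj.2⟩

lemma cg_had_last {n s : ℕ} (hn : 2 * s + 2 ≤ n) :
    NG.hadwiger n (cg n s s) ≤ n - 2 * s := by
  have ha : 2 * s < n := by omega
  have hb : 2 * s + 1 < n := by omega
  have hmem : ∀ u : Fin n, u ∉ Finset.Ici (⟨2 * s, ha⟩ : Fin n) → u.1 < 2 * s := by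
    intro u hu
    simpa [Fin.lt_def] using hu
  refine (had_le _ (Finset.Ici (⟨2 * s, ha⟩ : Fin n)) ?_ ?_).trans (by simp)
  · intro u v hu hv hadj
    have h1 := hmem u hu
    have h2 := hmem v hv
    exact col_out' (by omega) (by omega) hadj.2
  · intro z hz
    have h1 := hmem z hz
    by_cases hp : z.1 % 2 = 0
    · refine ⟨⟨2 * s, ha⟩, by simp, fun hadj => ?_⟩
      have := hadj.2
      simp only at this
      rw [min_eq_left (by omega), max_eq_right (by omega)] at this
      revert this
      unfold col
      split_ifs <;> omega
    · refine ⟨⟨2 * s + 1, hb⟩, by simp [Fin.le_def], fun hadj => ?_⟩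
      have := hadj.2
      simp only at this
      rw [min_eq_left (by omega), max_eq_right (by omega)] at this
      revert this
      unfold col
      split_ifs <;> omega

lemma cg_nd {n s : ℕ} (hn : 2 * s + 2 ≤ n) :
    NG.IsNDDecomp (fun i : Fin (s + 1) => cg n s i.1) := by
  refine ⟨⟨?_, ?_⟩, ?_⟩
  · intro i j hij
    rw [disjoint_iff]
    ext u v
    simp only [SimpleGraph.inf_adj, cg_adj, SimpleGraph.bot_adj, iff_false]
    rintro ⟨⟨_, h1⟩, ⟨_, h2⟩⟩
    exact hij (Fin.ext (h1.symm.trans h2))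
  · ext u v
    simp only [SimpleGraph.iSup_adj, cg_adj, SimpleGraph.top_adj]
    constructor
    · rintro ⟨i, h, _⟩
      exact h
    · intro h
      exact ⟨⟨_, Nat.lt_succ_of_le (col_le s (min u.1 v.1) (max u.1 v.1))⟩, h, rfl⟩
  · intro i hbot
    have hi := i.2
    have hadj : (cg n s i.1).Adj ⟨2 * i.1, by omega⟩ ⟨2 * i.1 + 1, by omega⟩ := by
      refine ⟨by simp [Fin.ext_iff], ?_⟩
      simp only
      rw [min_eq_left (by omega), max_eq_right (by omega)]
      unfold col
      split_ifs <;> omega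
    have hb : cg n s i.1 = ⊥ := hbot
    rw [hb] at hadj
    exact hadj

end NGP

/-- For all `r ≥ 2` and `n ≥ 2r`:
`(0.513)^(r−2)·n ≤ NGΠ↓ⁿ_η(r;n) ≤ 2^(r−1)·(n − 2r + 2)`. -/
theorem statement18 (r n : ℕ) (hr : 2 ≤ r) (hn : 2 * r ≤ n) :
    (0.513 : ℝ) ^ (r - 2) * n ≤ (NG.NGprodLowND (NG.hadwiger n) r : ℝ) ∧
    (NG.NGprodLowND (NG.hadwiger n) r : ℝ) ≤
      2 ^ (r - 1) * ((n : ℝ) - 2 * r + 2) := by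
  obtain ⟨s, rfl⟩ : ∃ s, r = s + 1 := ⟨r - 1, by omega⟩
  have hn' : 2 * s + 2 ≤ n := by omega
  have hmem : ∏ i : Fin (s + 1), NG.hadwiger n (NGP.cg n s i.1) ∈
      {t | ∃ G : Fin (s + 1) → SimpleGraph (Fin n), NG.IsNDDecomp G ∧
        ∏ i, NG.hadwiger n (G i) = t} := ⟨_, NGP.cg_nd hn', rfl⟩
  constructor
  · obtain ⟨G, hG, hprod⟩ := Nat.sInf_mem ⟨_, hmem⟩
    have h1 := NGP.main G _ Finset.univ rfl Finset.univ (fun i => NG.hadwiger n (G i))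
      (fun i _ => NGP.bd_had (G i)) (by
        intro u _ v _ huv
        have : (⨆ i, G i).Adj u v := by rw [hG.1.2]; exact huv
        obtain ⟨i, hi⟩ := SimpleGraph.iSup_adj.1 this
        exact ⟨i, Finset.mem_univ _, hi⟩)
    have h2 : (NG.NGprodLowND (NG.hadwiger n) (s + 1) : ℝ) =
        ∏ i, (NG.hadwiger n (G i) : ℝ) := by
      unfold NG.NGprodLowND
      rw [← hprod]
      push_cast
      rfl
    rw [← h2] at h1
    simp only [Finset.card_univ, Fintype.card_fin] at h1
    have h3 : (0.513 : ℝ) ^ (s + 1 - 2) * NGP.L ^ (s + 1 - 2) = 1 := by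
      rw [← mul_pow]
      have : (0.513 : ℝ) * NGP.L = 1 := by unfold NGP.L; norm_num
      rw [this, one_pow]
    calc (0.513 : ℝ) ^ (s + 1 - 2) * n ≤ (0.513 : ℝ) ^ (s + 1 - 2) *
          (NGP.L ^ (s + 1 - 2) * (NG.NGprodLowND (NG.hadwiger n) (s + 1) : ℝ)) :=
          mul_le_mul_of_nonneg_left h1 (by positivity)
      _ = (NG.NGprodLowND (NG.hadwiger n) (s + 1) : ℝ) := by rw [← mul_assoc, h3, one_mul]
  · have h1 : NG.NGprodLowND (NG.hadwiger n) (s + 1) ≤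
        ∏ i : Fin (s + 1), NG.hadwiger n (NGP.cg n s i.1) := Nat.sInf_le hmem
    have h2 : ∏ i : Fin (s + 1), NG.hadwiger n (NGP.cg n s i.1) ≤ 2 ^ s * (n - 2 * s) := by
      rw [Fin.prod_univ_castSucc]
      apply Nat.mul_le_mul
      · calc _ ≤ ∏ i : Fin s, 2 :=
              Finset.prod_le_prod' (fun i _ => NGP.cg_had_small i.2 hn')
          _ = 2 ^ s := by simp
      · exact NGP.cg_had_last hn'
    have h3 : (NG.NGprodLowND (NG.hadwiger n) (s + 1) : ℝ) ≤ ((2 ^ s * (n - 2 * s) : ℕ) : ℝ) :=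
      Nat.cast_le.2 (h1.trans h2)
    rw [Nat.cast_mul, Nat.cast_sub (by omega)] at h3
    push_cast at h3 ⊢
    have e : (n : ℝ) - 2 * (s + 1) + 2 = n - 2 * s := by ring
    rw [e]
    exact h3
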